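/- arXiv:0811.3005 — 2 statements merged into one kernel-verified Lean document; each statement's English description precedes it below -/
import Mathlib

section
/- There exist absolute constants A > 0 and a > 0 such that for every N ≥ 1 and every f: ℝ² → {-1,0,+1} vanishing outside [0,N]², taking values ±1 on [0,N]² and constant on unit cells, one has ∫_{a/N < |ξ| < A} |f̂(ξ)|² dξ ≥ N²/3. -/
open MeasureTheory Real FourierTransform

abbrev Pt := EuclideanSpace ℝ (Fin 2)

noncomputable def pt (a b : ℝ) : Pt := (WithLp.equiv 2 (Fin 2 → ℝ)).symm ![a, b]

/-- `f` is a (±1)-coloring of the `N × N` checkerboard `[0,N]²`: it takes values `±1`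
on `[0,N)²`, vanishes outside, and is constant on each unit cell `(i,j) + [0,1)²`. -/
def IsColoring (N : ℕ) (f : Pt → ℝ) : Prop :=
  (∀ x : Pt, (∀ i, x i ∈ Set.Ico (0:ℝ) N) → f x = 1 ∨ f x = -1) ∧
  (∀ x : Pt, ¬ (∀ i, x i ∈ Set.Ico (0:ℝ) N) → f x = 0) ∧
  (∀ i j : ℕ, i < N → j < N → ∀ x : Pt,
    x 0 ∈ Set.Ico (i:ℝ) (i+1) → x 1 ∈ Set.Ico (j:ℝ) (j+1) → f x = f (pt i j))

section Plancherel

variable {E : Type*} [NormedAddCommGroup E] [InnerProductSpace ℝ E] [FiniteDimensional ℝ E]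
  [MeasurableSpace E] [BorelSpace E]

/-- The `L²` Fourier transform of a function in `L¹ ∩ L²` is given by the Fourier integral. -/
theorem coeFn_fourier_toLp_ae_eq {f : E → ℂ} (h1 : Integrable f) (h2 : MemLp f 2) :
    (𝓕 (h2.toLp f) : Lp ℂ 2 (volume : Measure E)) =ᵐ[volume] 𝓕 f := by
  have hcont : Continuous (𝓕 f) :=
    VectorFourier.fourierIntegral_continuous Real.continuous_fourierChar
      (by exact continuous_inner) h1
  refine ae_eq_of_integral_contDiff_smul_eq
    ((Lp.memLp _).locallyIntegrable (by norm_num)) hcont.locallyIntegrable ?_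
  intro g hg hgc
  let φ : SchwartzMap E ℂ := HasCompactSupport.toSchwartzMap
    (f := fun x => (g x : ℂ)) (hgc.comp_left (g := fun r : ℝ => (r : ℂ)) (by simp))
    (Complex.ofRealCLM.contDiff.comp hg)
  have hφ : ∀ x, φ x = (g x : ℂ) := fun x => rfl
  have key := congrArg (fun u => u φ) (Lp.fourier_toTemperedDistribution_eq (h2.toLp f))
  rw [TemperedDistribution.fourier_apply, Lp.toTemperedDistribution_apply,
    Lp.toTemperedDistribution_apply] at key
  calc ∫ x, g x • (𝓕 (h2.toLp f) : Lp ℂ 2 (volume : Measure E)) x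
      = ∫ x, φ x • (𝓕 (h2.toLp f) : Lp ℂ 2 (volume : Measure E)) x := by
        simp [hφ]
    _ = ∫ x, (𝓕 φ) x • (h2.toLp f) x := key.symm
    _ = ∫ x, (𝓕 (φ : E → ℂ)) x • f x := by
        refine integral_congr_ae ?_
        filter_upwards [h2.coeFn_toLp] with x hx
        rw [hx, SchwartzMap.fourier_coe]
    _ = ∫ x, φ x • 𝓕 f x := by
        have := VectorFourier.integral_fourierIntegral_smul_eq_flip (μ := volume) (ν := volume)
          (L := innerₗ E) Real.continuous_fourierChar continuous_inner
          (φ.integrable (μ := volume)) h1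
        rw [flip_innerₗ] at this
        exact this
    _ = ∫ x, g x • 𝓕 f x := by simp [hφ]

/-- Plancherel's theorem for functions in `L¹ ∩ L²`. -/
theorem lintegral_enorm_fourier_sq {f : E → ℂ} (h1 : Integrable f) (h2 : MemLp f 2) :
    ∫⁻ ξ, ‖𝓕 f ξ‖ₑ ^ 2 = ∫⁻ x, ‖f x‖ₑ ^ 2 := by
  have h : ‖(𝓕 (h2.toLp f) : Lp ℂ 2 (volume : Measure E))‖ₑ = ‖h2.toLp f‖ₑ := by
    rw [← ofReal_norm, ← ofReal_norm, Lp.norm_fourier_eq]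
  rw [Lp.enorm_def, Lp.enorm_toLp, eLpNorm_congr_ae (coeFn_fourier_toLp_ae_eq h1 h2)] at h
  have := congrArg (· ^ 2) h
  have hsq : ∀ g : E → ℂ, eLpNorm g 2 volume ^ 2 = ∫⁻ x, ‖g x‖ₑ ^ 2 := fun g => by
    simpa using eLpNorm_nnreal_pow_eq_lintegral (f := g) (μ := volume) (p := 2) two_ne_zero
  simpa only [hsq] using this

theorem fourier_translate_sub {f : E → ℂ} (h1 : Integrable f) (h ξ : E) :
    𝓕 (fun x => f (x + h) - f x) ξ = ((𝐞 (inner ℝ h ξ) : ℂ) - 1) * 𝓕 f ξ := by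
  have ht := congrFun (VectorFourier.fourierIntegral_comp_add_right 𝐞 volume (innerₗ E) f h) ξ
  have hs : 𝓕 (fun x => f (x + h) - f x) ξ = 𝓕 (fun x => f (x + h)) ξ - 𝓕 f ξ := by
    simp only [Real.fourier_eq, smul_sub]
    exact integral_sub ((Real.fourierIntegral_convergent_iff ξ).2 (h1.comp_add_right h))
      ((Real.fourierIntegral_convergent_iff ξ).2 h1)
  rw [hs, sub_mul, one_mul]
  exact congrArg (· - 𝓕 f ξ) ht

end Plancherel

lemma norm_sq_fourierChar_sub_one (s : ℝ) :
    ‖(𝐞 s : ℂ) - 1‖ ^ 2 = 2 - 2 * cos (2 * π * s) := by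
  rw [Real.fourierChar_apply, Complex.exp_mul_I, ← Complex.normSq_eq_norm_sq,
    ← Complex.ofReal_cos, ← Complex.ofReal_sin, Complex.normSq_apply]
  simp only [Complex.sub_re, Complex.add_re, Complex.mul_re, Complex.sub_im, Complex.add_im,
    Complex.mul_im, Complex.ofReal_re, Complex.ofReal_im, Complex.I_re, Complex.I_im,
    Complex.one_re, Complex.one_im]
  linarith [sin_sq_add_cos_sq (2 * π * s)]

lemma le_integral_norm_sq_fourierChar_sub_one {T s : ℝ} (hT : 0 < T) (hs : 1 ≤ 3 * T * |s|) :
    T ≤ ∫ t in (0:ℝ)..T, ‖(𝐞 (t * s) : ℂ) - 1‖ ^ 2 := by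
  have hs0 : s ≠ 0 := by rintro rfl; norm_num at hs
  have hc : 2 * π * s ≠ 0 := by positivity
  have hcalc : ∫ t in (0:ℝ)..T, ‖(𝐞 (t * s) : ℂ) - 1‖ ^ 2
      = 2 * T - 2 * ((2 * π * s)⁻¹ * sin (2 * π * s * T)) := by
    simp_rw [norm_sq_fourierChar_sub_one, show ∀ t, 2 * π * (t * s) = 2 * π * s * t by intro; ring]
    rw [intervalIntegral.integral_sub (by simp) (by apply Continuous.intervalIntegrable; fun_prop),
      intervalIntegral.integral_const_mul, intervalIntegral.integral_comp_mul_left _ hc]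
    simp
    ring
  rw [hcalc]
  have h1 : 2 * ((2 * π * s)⁻¹ * sin (2 * π * s * T)) ≤ T := by
    refine (le_abs_self _).trans ?_
    rw [abs_mul, abs_mul, abs_inv, abs_mul, abs_of_pos (by positivity : 0 < 2 * π),
      abs_of_pos (by norm_num : (0:ℝ) < 2)]
    have h2 := abs_sin_le_one (2 * π * s * T)
    have h3 : 0 < |s| := abs_pos.2 hs0
    have h4 : 3 * T * |s| ≤ π * T * |s| := by gcongr; exact pi_gt_three.le
    calc 2 * ((2 * π * |s|)⁻¹ * |sin (2 * π * s * T)|) ≤ 2 * ((2 * π * |s|)⁻¹ * 1) := by gcongr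
      _ = 1 / (π * |s|) := by field_simp
      _ ≤ T := by rw [div_le_iff₀ (by positivity)]; linarith
  linarith

lemma volume_setOf_forall_mem (S : Fin 2 → Set ℝ) :
    volume {x : Pt | ∀ i, x i ∈ S i} = volume (S 0) * volume (S 1) := by
  have h := (EuclideanSpace.volume_preserving_symm_measurableEquiv_toLp
    (Fin 2)).measure_preimage_equiv (Set.univ.pi S)
  rw [volume_pi_pi, Fin.prod_univ_two] at h
  rw [← h]
  congr 1
  ext x
  simp

/-- The half-open square `[0,N)²`. -/
def boardSquare (N : ℕ) : Set Pt := {x | ∀ i, x i ∈ Set.Ico (0:ℝ) N}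

lemma measurableSet_boardSquare (N : ℕ) : MeasurableSet (boardSquare N) := by
  have : boardSquare N = ⋂ i, (fun x : Pt => x i) ⁻¹' Set.Ico (0:ℝ) N := by
    ext x; simp [boardSquare]
  rw [this]
  exact MeasurableSet.iInter fun i => measurableSet_Ico.preimage (by fun_prop)

lemma volume_boardSquare (N : ℕ) : volume (boardSquare N) = (N : ENNReal) ^ 2 := by
  rw [boardSquare, volume_setOf_forall_mem (fun _ => Set.Ico (0:ℝ) N)]
  simp [sq]

namespace IsColoring

variable {N : ℕ} {f : Pt → ℝ}

lemma eq_floor (hf : IsColoring N f) (x : Pt) : f x = f (pt ⌊x 0⌋ ⌊x 1⌋) := by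
  by_cases hx : ∀ i, x i ∈ Set.Ico (0:ℝ) N
  · have hfl : ∀ i, ∃ n : ℕ, n < N ∧ ⌊x i⌋ = n := fun i => by
      obtain ⟨n, hn⟩ := Int.eq_ofNat_of_zero_le (Int.floor_nonneg.2 (hx i).1)
      have h1 : ⌊x i⌋ < (N : ℤ) := Int.floor_lt.2 (by exact_mod_cast (hx i).2)
      exact ⟨n, by omega, hn⟩
    obtain ⟨m, hm, hm'⟩ := hfl 0
    obtain ⟨n, hn, hn'⟩ := hfl 1
    have h0 := Int.floor_eq_iff.1 hm'
    have h1 := Int.floor_eq_iff.1 hn'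
    rw [hm', hn']
    exact hf.2.2 m n hm hn x h0 h1
  · rw [hf.2.1 x hx, hf.2.1]
    contrapose! hx
    have h0 := hx 0
    have h1 := hx 1
    simp only [pt, WithLp.equiv_symm_apply, Set.mem_Ico, Matrix.cons_val_zero,
      Matrix.cons_val_one] at h0 h1
    have key : ∀ y : ℝ, (0:ℝ) ≤ ⌊y⌋ ∧ (⌊y⌋ : ℝ) < N → y ∈ Set.Ico (0:ℝ) N := fun y hy => by
      have h2 : ⌊y⌋ < (N : ℤ) := by exact_mod_cast hy.2
      exact ⟨hy.1.trans (Int.floor_le y), by exact_mod_cast Int.floor_lt.1 h2⟩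
    exact Fin.forall_fin_two.2 ⟨key _ h0, key _ h1⟩

lemma measurable (hf : IsColoring N f) : Measurable f := by
  have h : f = (fun p : ℤ × ℤ => f (pt p.1 p.2)) ∘ fun x : Pt => (⌊x 0⌋, ⌊x 1⌋) :=
    funext hf.eq_floor
  rw [h]
  exact (measurable_of_countable _).comp
    ((Int.measurable_floor.comp (by fun_prop)).prodMk (Int.measurable_floor.comp (by fun_prop)))

lemma norm_eq_indicator (hf : IsColoring N f) (x : Pt) :
    ‖(f x : ℂ)‖ = (boardSquare N).indicator (fun _ => (1:ℝ)) x := by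
  by_cases hx : x ∈ boardSquare N
  · rcases hf.1 x hx with h | h <;> simp [hx, h]
  · simp [hx, hf.2.1 x hx]

lemma memLp (hf : IsColoring N f) (p : ENNReal) : MemLp (fun x => (f x : ℂ)) p := by
  refine (memLp_indicator_const p (measurableSet_boardSquare N) (1:ℝ) (Or.inr ?_)).mono
    (Complex.measurable_ofReal.comp hf.measurable).aestronglyMeasurable
    (ae_of_all _ fun x => (hf.norm_eq_indicator x).le.trans (le_abs_self _))
  rw [volume_boardSquare]
  exact ENNReal.pow_ne_top (ENNReal.natCast_ne_top N)

lemma integrable (hf : IsColoring N f) : Integrable fun x => (f x : ℂ) :=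
  memLp_one_iff_integrable.1 (hf.memLp 1)

lemma integral_norm (hf : IsColoring N f) : ∫ x, ‖(f x : ℂ)‖ = (N : ℝ) ^ 2 := by
  simp_rw [hf.norm_eq_indicator]
  rw [integral_indicator_const _ (measurableSet_boardSquare N), Measure.real, volume_boardSquare]
  simp

lemma lintegral_enorm_sq (hf : IsColoring N f) :
    ∫⁻ x, ‖(f x : ℂ)‖ₑ ^ 2 = (N : ENNReal) ^ 2 := by
  have h : ∀ x, ‖(f x : ℂ)‖ₑ ^ 2 = (boardSquare N).indicator 1 x := fun x => by
    rw [← ofReal_norm, hf.norm_eq_indicator]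
    by_cases hx : x ∈ boardSquare N <;> simp [hx]
  simp_rw [h]
  rw [lintegral_indicator_one (measurableSet_boardSquare N), volume_boardSquare]

lemma exists_mem_strip_of_ne (hf : IsColoring N f) (k : Fin 2) {t : ℝ} (ht0 : 0 ≤ t) (ht1 : t ≤ 1)
    {x : Pt} (hx : f (x + EuclideanSpace.single k t) ≠ f x) :
    ∃ j ∈ Finset.range (N + 1), ∀ i, x i ∈ if i = k then Set.Ico ((j:ℝ) - t) j
      else Set.Ico (0:ℝ) N := by
  set y := x + EuclideanSpace.single k t with hy
  have hyk : y k = x k + t := by simp [hy]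
  have hyi : ∀ i, i ≠ k → y i = x i := fun i hi => by simp [hy, hi]
  have hfl : ⌊y k⌋ ≠ ⌊x k⌋ := fun he => hx <| by
    have hall : ∀ i, ⌊y i⌋ = ⌊x i⌋ := fun i => by
      by_cases hi : i = k
      · rw [hi, he]
      · rw [hyi i hi]
    rw [hf.eq_floor y, hf.eq_floor x, hall, hall]
  have hsq : (∀ i, y i ∈ Set.Ico (0:ℝ) N) ∨ ∀ i, x i ∈ Set.Ico (0:ℝ) N := by
    by_contra! hcon
    exact hx (by rw [hf.2.1 y (by push Not; exact hcon.1), hf.2.1 x (by push Not; exact hcon.2)])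
  have hlt : ⌊x k⌋ < ⌊y k⌋ := lt_of_le_of_ne (Int.floor_mono (by linarith)) hfl.symm
  have hxlt : x k < ⌊y k⌋ := Int.floor_lt.1 hlt
  have hle : (⌊y k⌋ : ℝ) ≤ x k + t := hyk ▸ Int.floor_le (y k)
  have hnn : 0 ≤ ⌊y k⌋ := by
    refine Int.floor_nonneg.2 ?_
    rcases hsq with h | h
    · exact (h k).1
    · linarith [(h k).1]
  have hN : ⌊y k⌋ < (N : ℤ) + 1 := by
    have : (⌊y k⌋ : ℝ) < N + 1 := by
      rcases hsq with h | h
      · linarith [(h k).2]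
      · linarith [(h k).2]
    exact_mod_cast this
  obtain ⟨j, hj⟩ := Int.eq_ofNat_of_zero_le hnn
  refine ⟨j, Finset.mem_range.2 (by omega), fun i => ?_⟩
  have hj' : (⌊y k⌋ : ℝ) = j := by rw [hj]; simp
  by_cases hi : i = k
  · subst hi
    rw [if_pos rfl, ← hj']
    exact ⟨by linarith, hxlt⟩
  · rw [if_neg hi]
    rcases hsq with h | h
    · exact hyi i hi ▸ h i
    · exact h i

lemma lintegral_enorm_translate_sub_sq_le (hf : IsColoring N f) (k : Fin 2) {t : ℝ} (ht0 : 0 ≤ t)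
    (ht1 : t ≤ 1) :
    ∫⁻ x, ‖(f (x + EuclideanSpace.single k t) : ℂ) - f x‖ₑ ^ 2
      ≤ ENNReal.ofReal (8 * t * N ^ 2) := by
  set S : ℕ → Set Pt := fun j => {x | ∀ i, x i ∈ if i = k then Set.Ico ((j:ℝ) - t) j
      else Set.Ico (0:ℝ) N} with hS
  have hnorm : ∀ x, ‖(f x : ℂ)‖ ≤ 1 := fun x => by
    rw [hf.norm_eq_indicator]
    exact Set.indicator_le_self' (by simp) x
  have hle : ∀ x, ‖(f (x + EuclideanSpace.single k t) : ℂ) - f x‖ₑ ^ 2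
      ≤ ∑ j ∈ Finset.range (N + 1), (S j).indicator (fun _ => 4) x := fun x => by
    by_cases hx : f (x + EuclideanSpace.single k t) = f x
    · simp [hx]
    · obtain ⟨j, hj, hjx⟩ := hf.exists_mem_strip_of_ne k ht0 ht1 hx
      refine le_trans ?_ (Finset.single_le_sum (f := fun j => (S j).indicator (fun _ => 4) x)
        (fun _ _ => zero_le) hj)
      rw [Set.indicator_of_mem (show x ∈ S j from hjx)]
      rw [← ofReal_norm, ← ENNReal.ofReal_pow (norm_nonneg _),
        show (4 : ENNReal) = ENNReal.ofReal (2 ^ 2) by norm_num]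
      gcongr
      refine (norm_sub_le _ _).trans ?_
      linarith [hnorm (x + EuclideanSpace.single k t), hnorm x]
  have hSm : ∀ j, MeasurableSet (S j) := fun j => by
    have : S j = ⋂ i, (fun x : Pt => x i) ⁻¹'
        (if i = k then Set.Ico ((j:ℝ) - t) j else Set.Ico (0:ℝ) N) := by
      ext x; simp [hS]
    rw [this]
    refine MeasurableSet.iInter fun i => MeasurableSet.preimage ?_ (by fun_prop)
    split_ifs <;> exact measurableSet_Ico
  have hSv : ∀ j, volume (S j) = ENNReal.ofReal (t * N) := fun j => by
    rw [hS, volume_setOf_forall_mem (fun i => if i = k then Set.Ico ((j:ℝ) - t) j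
      else Set.Ico (0:ℝ) N), ENNReal.ofReal_mul ht0]
    fin_cases k <;> simp [mul_comm]
  calc _ ≤ ∫⁻ x, ∑ j ∈ Finset.range (N + 1), (S j).indicator (fun _ => 4) x := lintegral_mono hle
    _ = ∑ j ∈ Finset.range (N + 1), 4 * ENNReal.ofReal (t * N) := by
      rw [lintegral_finsetSum _ fun j _ => measurable_const.indicator (hSm j)]
      simp_rw [lintegral_indicator_const (hSm _), hSv]
    _ = ENNReal.ofReal ((N + 1) * (4 * (t * N))) := by
      rw [Finset.sum_const, Finset.card_range, nsmul_eq_mul,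
        ENNReal.ofReal_mul (p := (N : ℝ) + 1) (by positivity),
        ENNReal.ofReal_mul (p := 4) (by norm_num)]
      norm_cast
    _ ≤ ENNReal.ofReal (8 * t * N ^ 2) := by
      refine ENNReal.ofReal_le_ofReal ?_
      have : (N : ℝ) ≤ N ^ 2 := by exact_mod_cast Nat.le_self_pow two_ne_zero N
      nlinarith

lemma continuous_fourier (hf : IsColoring N f) : Continuous (𝓕 fun x => (f x : ℂ)) :=
  VectorFourier.fourierIntegral_continuous Real.continuous_fourierChar
    (by exact continuous_inner) hf.integrable

lemma lintegral_fourierChar_sub_one_mul_le (hf : IsColoring N f) (k : Fin 2) {t : ℝ} (ht0 : 0 ≤ t)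
    (ht1 : t ≤ 1) :
    ∫⁻ ξ : Pt, ‖(𝐞 (t * ξ k) : ℂ) - 1‖ₑ ^ 2 * ‖𝓕 (fun x => (f x : ℂ)) ξ‖ₑ ^ 2
      ≤ ENNReal.ofReal (8 * t * N ^ 2) := by
  refine le_trans (le_of_eq ?_) (hf.lintegral_enorm_translate_sub_sq_le k ht0 ht1)
  have hmp := measurePreserving_add_right (volume : Measure Pt) (EuclideanSpace.single k t)
  refine Eq.trans ?_ (lintegral_enorm_fourier_sq
    ((hf.integrable.comp_add_right (EuclideanSpace.single k t)).sub hf.integrable)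
    (((hf.memLp 2).comp_measurePreserving hmp).sub (hf.memLp 2)))
  refine lintegral_congr fun ξ => ?_
  have := fourier_translate_sub hf.integrable (EuclideanSpace.single k t) ξ
  rw [EuclideanSpace.inner_single_left, conj_trivial] at this
  rw [← mul_pow, ← enorm_mul, ← this]

lemma lintegral_fourier_high_le (hf : IsColoring N f) (k : Fin 2) {T : ℝ} (hT0 : 0 < T)
    (hT1 : T ≤ 1) :
    ∫⁻ ξ in {ξ : Pt | 1 ≤ 3 * T * |ξ k|}, ‖𝓕 (fun x => (f x : ℂ)) ξ‖ₑ ^ 2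
      ≤ ENNReal.ofReal (8 * T * N ^ 2) := by
  set F := 𝓕 (fun x => (f x : ℂ)) with hF
  have hFm : Measurable F := hf.continuous_fourier.measurable
  have hem : Measurable fun p : Pt × ℝ => ‖(𝐞 (p.2 * p.1 k) : ℂ) - 1‖ₑ ^ 2 := by
    have : Continuous fun p : Pt × ℝ => (𝐞 (p.2 * p.1 k) : ℂ) - 1 := by
      have := Real.continuous_fourierChar
      fun_prop
    exact this.measurable.enorm.pow_const 2
  set H : Set Pt := {ξ : Pt | 1 ≤ 3 * T * |ξ k|} with hH
  have hHm : MeasurableSet H := measurableSet_le measurable_const (by fun_prop)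
  have hin : ∀ ξ ∈ H, ENNReal.ofReal T * ‖F ξ‖ₑ ^ 2 ≤
      ∫⁻ t in Set.Ioc 0 T, ‖(𝐞 (t * ξ k) : ℂ) - 1‖ₑ ^ 2 * ‖F ξ‖ₑ ^ 2 := fun ξ hξ => by
    have hd : Continuous fun t : ℝ => (𝐞 (t * ξ k) : ℂ) - 1 := by
      have := Real.continuous_fourierChar
      fun_prop
    have hc : Continuous fun t : ℝ => ‖(𝐞 (t * ξ k) : ℂ) - 1‖ ^ 2 := hd.norm.pow 2
    rw [lintegral_mul_const _ (hd.measurable.enorm.pow_const 2)]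
    gcongr
    refine (ENNReal.ofReal_le_ofReal (le_integral_norm_sq_fourierChar_sub_one hT0 hξ)).trans ?_
    rw [intervalIntegral.integral_of_le hT0.le, ofReal_integral_eq_lintegral_ofReal
      (hc.integrableOn_Ioc) (ae_of_all _ fun t => by positivity)]
    refine lintegral_mono fun t => ?_
    rw [ENNReal.ofReal_pow (norm_nonneg _), ofReal_norm]
  have key : ENNReal.ofReal T * ∫⁻ ξ in H, ‖F ξ‖ₑ ^ 2
      ≤ ENNReal.ofReal T * ENNReal.ofReal (8 * T * N ^ 2) := by
    calc _ = ∫⁻ ξ in H, ENNReal.ofReal T * ‖F ξ‖ₑ ^ 2 :=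
          (lintegral_const_mul _ (hFm.enorm.pow_const 2)).symm
      _ ≤ ∫⁻ ξ in H, ∫⁻ t in Set.Ioc 0 T, ‖(𝐞 (t * ξ k) : ℂ) - 1‖ₑ ^ 2 * ‖F ξ‖ₑ ^ 2 :=
          setLIntegral_mono' hHm hin
      _ ≤ ∫⁻ ξ, ∫⁻ t in Set.Ioc 0 T, ‖(𝐞 (t * ξ k) : ℂ) - 1‖ₑ ^ 2 * ‖F ξ‖ₑ ^ 2 :=
          setLIntegral_le_lintegral _ _
      _ = ∫⁻ t in Set.Ioc 0 T, ∫⁻ ξ, ‖(𝐞 (t * ξ k) : ℂ) - 1‖ₑ ^ 2 * ‖F ξ‖ₑ ^ 2 :=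
          lintegral_lintegral_swap
            (hem.mul ((hFm.comp measurable_fst).enorm.pow_const 2)).aemeasurable
      _ ≤ ∫⁻ t in Set.Ioc 0 T, ENNReal.ofReal (8 * T * N ^ 2) := by
          refine setLIntegral_mono' measurableSet_Ioc fun t ht => ?_
          refine (hf.lintegral_fourierChar_sub_one_mul_le k ht.1.le (ht.2.trans hT1)).trans ?_
          have := ht.2
          gcongr
      _ = _ := by rw [setLIntegral_const, Real.volume_Ioc, sub_zero, mul_comm]
  exact (ENNReal.mul_le_mul_iff_right (by simpa using hT0) ENNReal.ofReal_ne_top).1 key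

lemma lintegral_fourier_low_le (hf : IsColoring N f) (hN : 1 ≤ N) {a : ℝ} (ha : 0 < a) :
    ∫⁻ ξ in Metric.closedBall (0 : Pt) (a / N), ‖𝓕 (fun x => (f x : ℂ)) ξ‖ₑ ^ 2
      ≤ ENNReal.ofReal (π * a ^ 2 * N ^ 2) := by
  have hb : ∀ ξ, ‖𝓕 (fun x => (f x : ℂ)) ξ‖ₑ ^ 2 ≤ ENNReal.ofReal ((N:ℝ) ^ 4) := fun ξ => by
    have h : ‖𝓕 (fun x => (f x : ℂ)) ξ‖ ≤ (N:ℝ) ^ 2 := hf.integral_norm ▸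
      VectorFourier.norm_fourierIntegral_le_integral_norm 𝐞 volume (innerₗ Pt) _ ξ
    rw [← ofReal_norm, ← ENNReal.ofReal_pow (norm_nonneg _)]
    refine ENNReal.ofReal_le_ofReal ?_
    calc _ ≤ ((N:ℝ) ^ 2) ^ 2 := by gcongr
      _ = _ := by ring
  have hN' : (N : ℝ) ≠ 0 := by positivity
  calc _ ≤ ∫⁻ ξ in Metric.closedBall (0 : Pt) (a / N), ENNReal.ofReal ((N:ℝ) ^ 4) :=
        lintegral_mono hb
    _ = ENNReal.ofReal (π * a ^ 2 * N ^ 2) := by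
        rw [setLIntegral_const, EuclideanSpace.volume_closedBall_fin_two,
          ← ENNReal.ofReal_pow (by positivity), ← ENNReal.ofReal_mul (by positivity),
          ← ENNReal.ofReal_mul (by positivity)]
        congr 1
        field_simp

end IsColoring

/-- There are absolute constants `A > 0` and `a > 0` such that for every `N ≥ 1` and every
coloring `f` of the `N × N` checkerboard, the frequencies `a/N < |ξ| < A` carry at least a
third of the total mass: `∫_{a/N < |ξ| < A} |f̂(ξ)|² dξ ≥ N²/3`. -/
theorem coloring_medium_frequency_mass :
    ∃ A > (0:ℝ), ∃ a > (0:ℝ), ∀ (N : ℕ), 1 ≤ N → ∀ f : Pt → ℝ, IsColoring N f →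
      (N : ℝ) ^ 2 / 3 ≤
        ∫ ξ in {ξ : Pt | a / N < ‖ξ‖ ∧ ‖ξ‖ < A}, ‖𝓕 (fun x => (f x : ℂ)) ξ‖ ^ 2 := by
  refine ⟨48, by norm_num, 1 / 4, by norm_num, fun N hN f hf => ?_⟩
  set F := 𝓕 (fun x => (f x : ℂ)) with hF
  set M : Set Pt := {ξ : Pt | 1 / 4 / N < ‖ξ‖ ∧ ‖ξ‖ < 48} with hM
  set H : Fin 2 → Set Pt := fun k => {ξ : Pt | 1 ≤ 3 * (1 / 48) * |ξ k|} with hH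
  have htot : ∫⁻ ξ, ‖F ξ‖ₑ ^ 2 = ENNReal.ofReal ((N : ℝ) ^ 2) := by
    rw [hF, lintegral_enorm_fourier_sq hf.integrable (hf.memLp 2), hf.lintegral_enorm_sq]
    norm_cast
  have hcover : Set.univ ⊆ M ∪ (Metric.closedBall (0 : Pt) (1 / 4 / N) ∪ (H 0 ∪ H 1)) := by
    intro ξ _
    by_contra hξ
    simp only [Set.mem_union, not_or, hM, hH, Set.mem_ofPred_eq, mem_closedBall_zero_iff,
      not_le, not_and, not_lt] at hξ
    obtain ⟨h1, h2, h3, h4⟩ := hξ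
    have h5 := EuclideanSpace.norm_sq_eq ξ
    rw [Fin.sum_univ_two, Real.norm_eq_abs, Real.norm_eq_abs] at h5
    nlinarith [h1 h2, abs_nonneg (ξ 0), abs_nonneg (ξ 1)]
  set I := ∫⁻ ξ in M, ‖F ξ‖ₑ ^ 2 with hI
  have hIfin : I ≠ ⊤ := ne_top_of_le_ne_top (htot ▸ ENNReal.ofReal_ne_top)
    (setLIntegral_le_lintegral M _)
  have hsplit : ENNReal.ofReal ((N : ℝ) ^ 2) ≤ I + (ENNReal.ofReal (π * (1 / 4) ^ 2 * N ^ 2) +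
      (ENNReal.ofReal (8 * (1 / 48) * N ^ 2) + ENNReal.ofReal (8 * (1 / 48) * N ^ 2))) := by
    rw [← htot, ← setLIntegral_univ]
    refine (lintegral_mono_set hcover).trans ?_
    refine (lintegral_union_le _ _ _).trans (add_le_add le_rfl ?_)
    refine (lintegral_union_le _ _ _).trans (add_le_add
      (hf.lintegral_fourier_low_le hN (by norm_num)) ?_)
    exact (lintegral_union_le _ _ _).trans (add_le_add
      (hf.lintegral_fourier_high_le 0 (by norm_num) (by norm_num))
      (hf.lintegral_fourier_high_le 1 (by norm_num) (by norm_num)))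
  have hIeq : ∫ ξ in M, ‖F ξ‖ ^ 2 = I.toReal := by
    have hc : Continuous fun ξ => ‖F ξ‖ ^ 2 := hf.continuous_fourier.norm.pow 2
    rw [integral_eq_lintegral_of_nonneg_ae (ae_of_all _ fun ξ => sq_nonneg _)
      hc.aestronglyMeasurable]
    simp_rw [ENNReal.ofReal_pow (norm_nonneg _), ofReal_norm, hI]
  rw [hIeq]
  rw [← ENNReal.ofReal_toReal hIfin, ← ENNReal.ofReal_add (by positivity) (by positivity),
    ← ENNReal.ofReal_add (by positivity) (by positivity),
    ← ENNReal.ofReal_add (by positivity) (by positivity),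
    ENNReal.ofReal_le_ofReal_iff (by positivity)] at hsplit
  nlinarith [pi_lt_four, sq_nonneg (N : ℝ)]
end

section
/- Let f: ℝ² → {-1, 0, +1} vanish outside [0,N]², take values ±1 on [0,N]², and be constant on each unit cell (i,j)+[0,1)², 0 ≤ i,j < N. Then there exist x ∈ ℝ² and t ∈ (N/5, N/4) such that the circle of radius t centered at x has discrepancy |∫_{C(x,t)} f dσ| ≥ C N^{1/2} for an absolute constant C > 0. -/
open MeasureTheory Real FourierTransform

noncomputable def dir (θ : ℝ) : Pt := pt (Real.cos θ) (Real.sin θ)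

/-- The integral of `f` over the circle of radius `t` centered at `x`,
with respect to arc-length measure. -/
noncomputable def circDisc (f : Pt → ℝ) (t : ℝ) (x : Pt) : ℝ :=
  ∫ θ in (0:ℝ)..(2 * π), f (x + t • dir θ) * t


/-- `2π` times the Bessel function `J₀`. -/
noncomputable def besselInt (r : ℝ) : ℝ := ∫ θ in (0:ℝ)..(2 * π), cos (r * cos θ)

/-- The derivative of `besselInt`. -/
noncomputable def besselIntDeriv (r : ℝ) : ℝ :=
  ∫ θ in (0:ℝ)..(2 * π), -(cos θ * sin (r * cos θ))

lemma hasDerivAt_besselInt (r : ℝ) : HasDerivAt besselInt (besselIntDeriv r) r := by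
  refine (intervalIntegral.hasDerivAt_integral_of_dominated_loc_of_deriv_le
    (F := fun r θ => cos (r * cos θ)) (F' := fun r θ => -(cos θ * sin (r * cos θ)))
    (bound := fun _ => 1) Filter.univ_mem ?_ ?_ ?_ ?_ ?_ ?_).2
  · exact Filter.Eventually.of_forall fun x => by
      exact (Continuous.aestronglyMeasurable (by fun_prop))
  · exact Continuous.intervalIntegrable (by fun_prop) _ _
  · exact (Continuous.aestronglyMeasurable (by fun_prop))
  · refine Filter.Eventually.of_forall fun θ _ x _ => ?_
    rw [norm_neg, norm_mul]
    exact mul_le_one₀ (abs_cos_le_one _) (abs_nonneg _) (abs_sin_le_one _)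
  · exact Continuous.intervalIntegrable (by fun_prop) _ _
  · refine Filter.Eventually.of_forall fun θ _ x _ => ?_
    refine HasDerivAt.congr_deriv ((hasDerivAt_id x).mul_const (cos θ)).cos ?_
    simp; ring

lemma besselIntDeriv_ibp (r : ℝ) :
    besselIntDeriv r = -r * ∫ θ in (0:ℝ)..(2 * π), sin θ ^ 2 * cos (r * cos θ) := by
  have h := intervalIntegral.integral_mul_deriv_eq_deriv_mul (a := 0) (b := 2 * π)
    (u := sin) (v := fun θ => sin (r * cos θ)) (u' := cos)
    (v' := fun θ => cos (r * cos θ) * (r * -sin θ))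
    (fun x _ => hasDerivAt_sin x) (fun x _ => ((hasDerivAt_cos x).const_mul r).sin)
    (Continuous.intervalIntegrable (by fun_prop) _ _)
    (Continuous.intervalIntegrable (by fun_prop) _ _)
  simp only [sin_two_pi, sin_zero, zero_mul, sub_zero, zero_sub] at h
  rw [besselIntDeriv, intervalIntegral.integral_neg, ← h, ← intervalIntegral.integral_const_mul]
  congr 1; ext θ; ring

/-- Bessel's equation `y'' = -y - y' / r`. -/
lemma hasDerivAt_besselIntDeriv {r : ℝ} (hr : r ≠ 0) :
    HasDerivAt besselIntDeriv (-besselInt r - besselIntDeriv r / r) r := by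
  have h : HasDerivAt besselIntDeriv
      (∫ θ in (0:ℝ)..(2 * π), -(cos θ ^ 2 * cos (r * cos θ))) r := by
    refine (intervalIntegral.hasDerivAt_integral_of_dominated_loc_of_deriv_le
      (F := fun r θ => -(cos θ * sin (r * cos θ)))
      (F' := fun r θ => -(cos θ ^ 2 * cos (r * cos θ)))
      (bound := fun _ => 1) Filter.univ_mem ?_ ?_ ?_ ?_ ?_ ?_).2
    · exact Filter.Eventually.of_forall fun x => by
        exact (Continuous.aestronglyMeasurable (by fun_prop))
    · exact Continuous.intervalIntegrable (by fun_prop) _ _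
    · exact (Continuous.aestronglyMeasurable (by fun_prop))
    · refine Filter.Eventually.of_forall fun θ _ x _ => ?_
      rw [norm_neg, norm_mul, norm_pow]
      exact mul_le_one₀ (pow_le_one₀ (abs_nonneg _) (abs_cos_le_one _)) (abs_nonneg _)
        (abs_cos_le_one _)
    · exact Continuous.intervalIntegrable (by fun_prop) _ _
    · refine Filter.Eventually.of_forall fun θ _ x _ => ?_
      refine HasDerivAt.congr_deriv
        (((hasDerivAt_id x).mul_const (cos θ)).sin.const_mul (cos θ)).neg ?_
      simp; ring
  convert h using 1
  rw [besselIntDeriv_ibp, mul_comm, mul_div_assoc, neg_div, div_self hr, mul_neg_one, sub_neg_eq_add,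
    besselInt, ← intervalIntegral.integral_neg, ← intervalIntegral.integral_add
    (Continuous.intervalIntegrable (by fun_prop) _ _)
    (Continuous.intervalIntegrable (by fun_prop) _ _)]
  congr 1; ext θ; rw [sin_sq]; ring

lemma continuous_besselInt : Continuous besselInt :=
  continuous_iff_continuousAt.2 fun r => (hasDerivAt_besselInt r).continuousAt

lemma besselInt_pos {r : ℝ} (h0 : 0 ≤ r) (h1 : r ≤ 1) : 0 < besselInt r := by
  refine intervalIntegral.intervalIntegral_pos_of_pos (Continuous.intervalIntegrable (by fun_prop) _ _)
    (fun θ => ?_) (by positivity)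
  have h : |r * cos θ| ≤ 1 := by
    rw [abs_mul, abs_of_nonneg h0]; exact mul_le_one₀ h1 (abs_nonneg _) (abs_cos_le_one _)
  have := abs_le.1 h
  exact cos_pos_of_mem_Ioo ⟨by linarith [pi_gt_three], by linarith [pi_gt_three]⟩

/-- The energy of the Liouville normal form of Bessel's equation. -/
noncomputable def besselEnergy (r : ℝ) : ℝ :=
  r * (besselIntDeriv r ^ 2 + besselInt r ^ 2) + besselInt r * besselIntDeriv r
    + besselInt r ^ 2 / (2 * r)

lemma hasDerivAt_besselEnergy {r : ℝ} (hr : 0 < r) :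
    HasDerivAt besselEnergy (-(besselInt r ^ 2 / (2 * r ^ 2))) r := by
  have hy := hasDerivAt_besselInt r
  have hd := hasDerivAt_besselIntDeriv hr.ne'
  refine HasDerivAt.congr_deriv
    ((((hasDerivAt_id r).mul ((hd.pow 2).add (hy.pow 2))).add (hy.mul hd)).add
    ((hy.pow 2).div ((hasDerivAt_id r).const_mul 2) (by simp [hr.ne']))) ?_
  simp
  field_simp
  ring

lemma abs_mul_le_besselEnergy {r : ℝ} (hr : 0 < r) :
    r * besselInt r ^ 2 ≤ besselEnergy r ∧
    2 * |r * besselInt r * besselIntDeriv r + besselInt r ^ 2 / 2| ≤ besselEnergy r := by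
  unfold besselEnergy
  generalize besselInt r = y
  generalize besselIntDeriv r = z
  have e : r * (z ^ 2 + y ^ 2) + y * z + y ^ 2 / (2 * r)
      = r * y ^ 2 + r * (z + y / (2 * r)) ^ 2 + y ^ 2 / (4 * r) := by
    field_simp; ring
  have e2 : r * y * z + y ^ 2 / 2 = r * (y * (z + y / (2 * r))) := by
    field_simp
  have p : 0 ≤ y ^ 2 / (4 * r) := by positivity
  rw [e, e2, abs_mul, abs_of_pos hr]
  generalize z + y / (2 * r) = w
  refine ⟨by nlinarith [mul_nonneg hr.le (sq_nonneg w)], ?_⟩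
  have : 2 * |y * w| ≤ y ^ 2 + w ^ 2 := by
    rw [abs_mul]; nlinarith [sq_nonneg (|y| - |w|), sq_abs y, sq_abs w]
  nlinarith [mul_le_mul_of_nonneg_left this hr.le]

lemma besselEnergy_one_pos : 0 < besselEnergy 1 := by
  have := (abs_mul_le_besselEnergy one_pos).1
  have h := besselInt_pos zero_le_one le_rfl
  nlinarith

lemma besselEnergy_le {r : ℝ} (hr : 1 ≤ r) : besselEnergy r ≤ besselEnergy 1 := by
  have : AntitoneOn besselEnergy (Set.Ici 1) := by
    refine antitoneOn_of_deriv_nonpos (convex_Ici 1)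
      (fun x hx => (hasDerivAt_besselEnergy (one_pos.trans_le hx)).continuousAt.continuousWithinAt)
      (fun x hx => ?_) fun x hx => ?_
    · rw [interior_Ici] at hx
      exact (hasDerivAt_besselEnergy
        (one_pos.trans hx)).differentiableAt.differentiableWithinAt
    · rw [interior_Ici] at hx
      rw [(hasDerivAt_besselEnergy (one_pos.trans hx)).deriv, neg_nonpos]
      positivity
  exact this (Set.mem_Ici.2 le_rfl) hr hr

lemma le_besselEnergy {r : ℝ} (hr : 1 ≤ r) : 3 / 4 * besselEnergy 1 ≤ besselEnergy r := by
  have hder : ∀ x : ℝ, 0 < x → HasDerivAt (fun r => besselEnergy r * exp (-(4 * r ^ 2)⁻¹))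
      (exp (-(4 * x ^ 2)⁻¹) * (besselEnergy x - x * besselInt x ^ 2) / (2 * x ^ 3)) x := by
    intro x hx
    refine HasDerivAt.congr_deriv ((hasDerivAt_besselEnergy hx).mul
      ((((hasDerivAt_id x).pow 2).const_mul 4).inv (by simp [hx.ne'])).neg.exp) ?_
    simp
    field_simp
    ring
  have : MonotoneOn (fun r => besselEnergy r * exp (-(4 * r ^ 2)⁻¹)) (Set.Ici 1) := by
    refine monotoneOn_of_deriv_nonneg (convex_Ici 1)
      (fun x hx => (hder x (one_pos.trans_le hx)).continuousAt.continuousWithinAt)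
      (fun x hx => ?_) fun x hx => ?_
    · rw [interior_Ici] at hx
      exact (hder x (one_pos.trans hx)).differentiableAt.differentiableWithinAt
    · rw [interior_Ici] at hx
      have hx0 : 0 < x := one_pos.trans hx
      rw [(hder x hx0).deriv]
      have := sub_nonneg.2 (abs_mul_le_besselEnergy hx0).1
      positivity
  have h := this (Set.mem_Ici.2 le_rfl) hr hr
  have hE : 0 ≤ besselEnergy r :=
    le_trans (by positivity) (abs_mul_le_besselEnergy (one_pos.trans_le hr)).1
  have h1 : exp (-(4 * r ^ 2)⁻¹) ≤ 1 := exp_le_one_iff.2 (by simp; positivity)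
  have h2 : (3:ℝ) / 4 ≤ exp (-(4 * 1 ^ 2)⁻¹) := by
    have := add_one_le_exp (-(4 * 1 ^ 2)⁻¹ : ℝ)
    norm_num at this ⊢; linarith
  simp only at h
  nlinarith [besselEnergy_one_pos]

lemma le_integral_besselInt_sq_of_large {l : ℝ} (hl : 80 ≤ l) :
    besselEnergy 1 / 40 ≤ ∫ r in (l / 5)..(l / 4), besselInt r ^ 2 := by
  have hle : l / 5 ≤ l / 4 := by linarith
  have hr : ∀ r ∈ Set.uIcc (l / 5) (l / 4), 1 ≤ r ∧ r ≤ l / 4 := by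
    intro r h; rw [Set.uIcc_of_le hle] at h; exact ⟨by linarith [h.1], h.2⟩
  set V : ℝ → ℝ := fun r => r * besselInt r * besselIntDeriv r + besselInt r ^ 2 / 2 with hV
  have hderV : ∀ r ∈ Set.uIcc (l / 5) (l / 4), HasDerivAt V
      (besselEnergy r - (2 * r + (2 * r)⁻¹) * besselInt r ^ 2) r := by
    intro r h
    have h0 : 0 < r := one_pos.trans_le (hr r h).1
    have hy := hasDerivAt_besselInt r
    have hd := hasDerivAt_besselIntDeriv h0.ne'
    refine HasDerivAt.congr_deriv
      ((((hasDerivAt_id r).mul hy).mul hd).add ((hy.pow 2).div_const 2)) ?_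
    simp [besselEnergy]
    field_simp
    ring
  have hc : ContinuousOn besselEnergy (Set.uIcc (l / 5) (l / 4)) := fun r h =>
    (hasDerivAt_besselEnergy (one_pos.trans_le (hr r h).1)).continuousAt.continuousWithinAt
  have hc2 : ContinuousOn (fun r => (2 * r + (2 * r)⁻¹) * besselInt r ^ 2)
      (Set.uIcc (l / 5) (l / 4)) := by
    refine ContinuousOn.mul (ContinuousOn.add (by fun_prop) (ContinuousOn.inv₀ (by fun_prop)
      fun r h => ?_)) (continuous_besselInt.pow 2).continuousOn
    have := (hr r h).1; positivity
  have hftc := intervalIntegral.integral_eq_sub_of_hasDerivAt hderV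
    (hc.sub hc2).intervalIntegrable
  rw [intervalIntegral.integral_sub hc.intervalIntegrable hc2.intervalIntegrable] at hftc
  have hVb : ∀ r ∈ Set.uIcc (l / 5) (l / 4), 2 * |V r| ≤ besselEnergy 1 := fun r h =>
    (abs_mul_le_besselEnergy (one_pos.trans_le (hr r h).1)).2.trans (besselEnergy_le (hr r h).1)
  have hV1 := abs_le.1 ((le_div_iff₀' two_pos).2 (hVb _ Set.left_mem_uIcc))
  have hV2 := abs_le.1 ((le_div_iff₀' two_pos).2 (hVb _ Set.right_mem_uIcc))
  have hE : (l / 4 - l / 5) * (3 / 4 * besselEnergy 1) ≤ ∫ r in (l / 5)..(l / 4), besselEnergy r := by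
    have := intervalIntegral.integral_mono_on (μ := volume) hle
      (intervalIntegrable_const (c := 3 / 4 * besselEnergy 1))
      hc.intervalIntegrable fun r h => le_besselEnergy (hr r (Set.Icc_subset_uIcc h)).1
    rwa [intervalIntegral.integral_const, smul_eq_mul] at this
  have hY : ∫ r in (l / 5)..(l / 4), (2 * r + (2 * r)⁻¹) * besselInt r ^ 2
      ≤ l * ∫ r in (l / 5)..(l / 4), besselInt r ^ 2 := by
    rw [← intervalIntegral.integral_const_mul]
    refine intervalIntegral.integral_mono_on hle hc2.intervalIntegrable
      (((continuous_besselInt.pow 2).const_mul l).intervalIntegrable _ _) fun r h => ?_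
    obtain ⟨h1, h2⟩ := hr r (Set.Icc_subset_uIcc h)
    have : (2 * r)⁻¹ ≤ 1 := inv_le_one_of_one_le₀ (by linarith)
    gcongr
    linarith
  have hE1 := besselEnergy_one_pos
  have : l * (besselEnergy 1 / 40) ≤ l * ∫ r in (l / 5)..(l / 4), besselInt r ^ 2 := by
    nlinarith
  exact le_of_mul_le_mul_left this (by linarith)

lemma besselInt_sq_add_sq_pos {r : ℝ} (hr : 0 < r) :
    0 < besselIntDeriv r ^ 2 + besselInt r ^ 2 := by
  rcases le_total r 1 with h | h
  · have := besselInt_pos hr.le h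
    positivity
  · have hE := le_besselEnergy h
    by_contra hc
    have h1 : besselIntDeriv r = 0 := by nlinarith [sq_nonneg (besselInt r), sq_nonneg (besselIntDeriv r)]
    have h2 : besselInt r = 0 := by nlinarith [sq_nonneg (besselInt r), sq_nonneg (besselIntDeriv r)]
    have := besselEnergy_one_pos
    simp [besselEnergy, h1, h2] at hE
    simp only [besselEnergy, one_mul] at this
    linarith

lemma integral_besselInt_sq_pos {l : ℝ} (hl : 0 ≤ l) :
    0 < ∫ s in (1 / 5 : ℝ)..(1 / 4), besselInt (l * s) ^ 2 := by
  have hc : Continuous fun s => besselInt (l * s) ^ 2 :=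
    (continuous_besselInt.comp (continuous_const_mul l)).pow 2
  refine intervalIntegral.integral_pos (by norm_num) hc.continuousOn
    (fun _ _ => sq_nonneg _) ?_
  by_contra! h
  have hz : ∀ s ∈ Set.Icc (1 / 5 : ℝ) (1 / 4), besselInt (l * s) = 0 := fun s hs =>
    pow_eq_zero_iff two_ne_zero |>.1 (le_antisymm (h s hs) (sq_nonneg _))
  rcases hl.eq_or_lt with rfl | hl
  · have := hz (1 / 5) (by norm_num)
    rw [zero_mul] at this
    exact (besselInt_pos le_rfl zero_le_one).ne' this
  · have hd : HasDerivAt (fun s => besselInt (l * s)) (besselIntDeriv (l * (9 / 40)) * (l * 1))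
        (9 / 40) :=
      (hasDerivAt_besselInt (l * (9 / 40))).comp (9 / 40 : ℝ) ((hasDerivAt_id _).const_mul l)
    have h0 : HasDerivAt (fun s => besselInt (l * s)) 0 (9 / 40) := by
      refine (hasDerivAt_const (9 / 40 : ℝ) (0:ℝ)).congr_of_eventuallyEq ?_
      filter_upwards [Icc_mem_nhds (a := (1 / 5 : ℝ)) (b := 1 / 4) (by norm_num) (by norm_num)]
        with s hs using hz s hs
    have := hd.unique h0
    have h1 : besselIntDeriv (l * (9 / 40)) = 0 := by
      simpa [hl.ne'] using this
    have := besselInt_sq_add_sq_pos (r := l * (9 / 40)) (by positivity)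
    rw [h1, hz (9 / 40) (by norm_num)] at this
    simp at this

lemma exists_le_integral_besselInt_sq :
    ∃ c > 0, ∀ l : ℝ, 0 ≤ l →
      c / (1 + l) ≤ ∫ s in (1 / 5 : ℝ)..(1 / 4), besselInt (l * s) ^ 2 := by
  have hcont : Continuous fun l : ℝ => ∫ s in (1 / 5 : ℝ)..(1 / 4), besselInt (l * s) ^ 2 := by
    refine intervalIntegral.continuous_parametric_intervalIntegral_of_continuous' ?_ _ _
    exact (continuous_besselInt.comp (continuous_fst.mul continuous_snd)).pow 2
  obtain ⟨l₀, hl₀, hmin⟩ := (isCompact_Icc (a := (0:ℝ)) (b := 80)).exists_isMinOn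
    ⟨0, by norm_num⟩ hcont.continuousOn
  have hm := integral_besselInt_sq_pos hl₀.1
  set m := ∫ s in (1 / 5 : ℝ)..(1 / 4), besselInt (l₀ * s) ^ 2
  have hE := besselEnergy_one_pos
  refine ⟨min m (besselEnergy 1 / 40), lt_min hm (by positivity), fun l hl => ?_⟩
  rcases le_total l 80 with h | h
  · have h1 : m ≤ ∫ s in (1 / 5 : ℝ)..(1 / 4), besselInt (l * s) ^ 2 := hmin ⟨hl, h⟩
    refine le_trans ?_ h1
    rw [div_le_iff₀ (by positivity)]
    nlinarith [min_le_left m (besselEnergy 1 / 40)]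
  · have hpos : 0 < l := by linarith
    have h1 := le_integral_besselInt_sq_of_large h
    have h2 := intervalIntegral.integral_comp_mul_left (a := 1 / 5) (b := 1 / 4)
      (fun r => besselInt r ^ 2) hpos.ne'
    rw [show l * (1 / 5) = l / 5 by ring, show l * (1 / 4) = l / 4 by ring, smul_eq_mul] at h2
    rw [h2, div_le_iff₀ (by positivity)]
    have h3 : min m (besselEnergy 1 / 40) ≤ ∫ r in (l / 5)..(l / 4), besselInt r ^ 2 :=
      (min_le_right _ _).trans h1
    have h4 : 1 ≤ l⁻¹ * (1 + l) := by field_simp; linarith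
    have h5 : 0 ≤ ∫ r in (l / 5)..(l / 4), besselInt r ^ 2 := le_trans (by positivity) h1
    nlinarith

/-- The character `x ↦ exp (2πix)`. -/
noncomputable def expI (x : ℝ) : ℂ := Complex.exp ((2 * π * x : ℝ) * Complex.I)

lemma expI_add (x y : ℝ) : expI (x + y) = expI x * expI y := by
  rw [expI, expI, expI, ← Complex.exp_add]; congr 1; push_cast; ring

lemma norm_expI (x : ℝ) : ‖expI x‖ = 1 := Complex.norm_exp_ofReal_mul_I _

lemma expI_re (x : ℝ) : (expI x).re = cos (2 * π * x) := Complex.exp_ofReal_mul_I_re _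

@[fun_prop]
lemma continuous_expI : Continuous expI := by unfold expI; fun_prop

lemma conj_expI (x : ℝ) : (starRingEnd ℂ) (expI x) = expI (-x) := by
  rw [expI, expI, ← Complex.exp_conj, map_mul, Complex.conj_ofReal, Complex.conj_I]
  congr 1; push_cast; ring

lemma expI_nat_mul (n : ℕ) (x : ℝ) : expI (n * x) = expI x ^ n := by
  rw [expI, expI, ← Complex.exp_nat_mul]; congr 1; push_cast; ring

lemma expI_eq_one_iff {x : ℝ} : expI x = 1 ↔ ∃ n : ℤ, x = n := by
  rw [expI, Complex.exp_eq_one_iff]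
  refine exists_congr fun n => ?_
  rw [show (n : ℂ) * (2 * π * Complex.I) = ((2 * π * n : ℝ) : ℂ) * Complex.I by push_cast; ring,
    mul_left_inj' Complex.I_ne_zero, Complex.ofReal_inj, mul_right_inj' (by positivity)]

/-- The coordinates of the symmetric window `{-K, …, K}`. -/
def ctr (K : ℕ) (p : Fin (2 * K + 1)) : ℝ := (p : ℕ) - (K : ℝ)

lemma abs_ctr_le {K : ℕ} (p : Fin (2 * K + 1)) : |ctr K p| ≤ K := by
  have h : (p : ℕ) ≤ 2 * K := by omega
  have h' : ((p : ℕ) : ℝ) ≤ 2 * K := by exact_mod_cast h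
  rw [ctr, abs_le]
  constructor <;> linarith [(Nat.cast_nonneg (p : ℕ) : (0:ℝ) ≤ _)]

lemma sum_expI_ctr {K : ℕ} (p r : Fin (2 * K + 1)) :
    ∑ q, expI (ctr K q * (ctr K p - ctr K r) / (2 * K + 1)) =
      if p = r then (2 * K + 1 : ℂ) else 0 := by
  split_ifs with h
  · subst h; simp [expI]
  set x : ℝ := (ctr K p - ctr K r) / (2 * K + 1) with hx
  have hL : (0:ℝ) < 2 * K + 1 := by positivity
  have hxL : x * (2 * K + 1) = ((p : ℕ) : ℝ) - (r : ℕ) := by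
    rw [hx, div_mul_cancel₀ _ hL.ne', ctr, ctr]; ring
  have hterm : ∀ q : Fin (2 * K + 1),
      expI (ctr K q * (ctr K p - ctr K r) / (2 * K + 1)) = expI (-K * x) * expI x ^ (q : ℕ) := by
    intro q
    rw [← expI_nat_mul, ← expI_add, mul_div_assoc, ← hx, ctr]; congr 1; ring
  rw [Finset.sum_congr rfl fun q _ => hterm q, ← Finset.mul_sum,
    Fin.sum_univ_eq_sum_range (fun q => expI x ^ q)]
  have hne : expI x ≠ 1 := by
    rw [Ne, expI_eq_one_iff]
    rintro ⟨n, hn⟩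
    rw [hn] at hxL
    have h1 : n * (2 * K + 1) = ((p : ℕ) : ℤ) - ((r : ℕ) : ℤ) := by exact_mod_cast hxL
    have hn0 : n = 0 := by
      by_contra h0
      rcases lt_or_gt_of_ne h0 with h0 | h0 <;> have := p.2 <;> have := r.2 <;> nlinarith
    rw [hn0] at h1
    exact h (Fin.ext (by omega))
  have hpow : expI x ^ (2 * K + 1) = 1 := by
    rw [← expI_nat_mul, expI_eq_one_iff]
    refine ⟨(p : ℕ) - (r : ℕ), ?_⟩
    push_cast
    rw [mul_comm, hxL]
  rw [geom_sum_eq hne, hpow, sub_self, zero_div, mul_zero]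

lemma sum_norm_sq_of_orthogonal {ι κ : Type*} [Fintype ι] [Fintype κ] [DecidableEq ι]
    (e : ι → κ → ℂ) (R : ℝ)
    (he : ∀ p r, ∑ q, e p q * (starRingEnd ℂ) (e r q) = if p = r then (R : ℂ) else 0)
    (a : ι → ℂ) : ∑ q, ‖∑ p, a p * e p q‖ ^ 2 = R * ∑ p, ‖a p‖ ^ 2 := by
  have h : ((∑ q, ‖∑ p, a p * e p q‖ ^ 2 : ℝ) : ℂ) = ((R * ∑ p, ‖a p‖ ^ 2 : ℝ) : ℂ) := by
    push_cast
    simp_rw [← Complex.mul_conj', map_sum, Finset.sum_mul_sum, map_mul]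
    rw [Finset.sum_comm, Finset.mul_sum]
    refine Finset.sum_congr rfl fun p _ => ?_
    rw [Finset.sum_comm]
    have : ∀ r, ∑ q, a p * e p q * ((starRingEnd ℂ) (a r) * (starRingEnd ℂ) (e r q)) =
        if p = r then R * (a p * (starRingEnd ℂ) (a p)) else 0 := by
      intro r
      rw [show ∑ q, a p * e p q * ((starRingEnd ℂ) (a r) * (starRingEnd ℂ) (e r q)) =
        a p * (starRingEnd ℂ) (a r) * ∑ q, e p q * (starRingEnd ℂ) (e r q) by
          rw [Finset.mul_sum]; exact Finset.sum_congr rfl fun q _ => by ring, he]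
      split_ifs with h
      · subst h; ring
      · ring
    simp [this]
  exact_mod_cast h

/-- The frequencies of the discrete Fourier transform on the window. -/
noncomputable def freq {K : ℕ} (q : Fin (2 * K + 1)) : ℝ := ctr K q / (2 * K + 1)

lemma abs_freq_le {K : ℕ} (q : Fin (2 * K + 1)) : |freq q| ≤ 1 / 2 := by
  rw [freq, abs_div, abs_of_pos (a := (2 * K + 1 : ℝ)) (by positivity), div_le_iff₀ (by positivity)]
  linarith [abs_ctr_le q]

lemma parseval_window {K : ℕ} (a : Fin (2 * K + 1) × Fin (2 * K + 1) → ℂ) :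
    ∑ q : Fin (2 * K + 1) × Fin (2 * K + 1),
      ‖∑ p, a p * expI (-(ctr K p.1 * freq q.1 + ctr K p.2 * freq q.2))‖ ^ 2 =
      (2 * K + 1) ^ 2 * ∑ p, ‖a p‖ ^ 2 := by
  refine sum_norm_sq_of_orthogonal
    (fun p q : Fin (2 * K + 1) × Fin (2 * K + 1) =>
      expI (-(ctr K p.1 * freq q.1 + ctr K p.2 * freq q.2))) _ (fun p r => ?_) a
  have : ∀ q : Fin (2 * K + 1) × Fin (2 * K + 1),
      expI (-(ctr K p.1 * freq q.1 + ctr K p.2 * freq q.2)) *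
        (starRingEnd ℂ) (expI (-(ctr K r.1 * freq q.1 + ctr K r.2 * freq q.2))) =
      expI (ctr K q.1 * (ctr K r.1 - ctr K p.1) / (2 * K + 1)) *
        expI (ctr K q.2 * (ctr K r.2 - ctr K p.2) / (2 * K + 1)) := by
    intro q
    rw [conj_expI, ← expI_add, ← expI_add, freq, freq]; congr 1; ring
  simp_rw [this]
  rw [Fintype.sum_prod_type]
  simp_rw [← Finset.mul_sum]
  rw [← Finset.sum_mul, sum_expI_ctr, sum_expI_ctr]
  simp only [Prod.ext_iff, eq_comm (a := p.1), eq_comm (a := p.2)]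
  split_ifs <;> simp_all
  ring

lemma sum_norm_integral_sq_le {X ι : Type*} [Fintype ι] [MeasurableSpace X] {μ : Measure X}
    [IsProbabilityMeasure μ] {h : X → ι → ℂ} (hint : ∀ i, Integrable (fun x => h x i) μ) {B : ℝ}
    (hB : ∀ x, ∑ i, ‖h x i‖ ^ 2 ≤ B) : ∑ i, ‖∫ x, h x i ∂μ‖ ^ 2 ≤ B := by
  set g : X → EuclideanSpace ℂ ι := fun x => WithLp.toLp 2 (h x) with hg
  have hev : ∀ i, (∫ x, g x ∂μ) i = ∫ x, h x i ∂μ := fun i => eval_integral_piLp hint i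
  have hB0 : 0 ≤ B := by
    obtain ⟨x⟩ : Nonempty X := nonempty_of_isProbabilityMeasure μ
    exact (Finset.sum_nonneg fun i _ => sq_nonneg _).trans (hB x)
  have hn : ‖∫ x, g x ∂μ‖ ≤ √B := by
    refine (norm_integral_le_of_norm_le_const (C := √B) (Filter.Eventually.of_forall fun x => ?_)).trans
      (by simp)
    rw [EuclideanSpace.norm_eq]
    exact Real.sqrt_le_sqrt (hB x)
  have := pow_le_pow_left₀ (norm_nonneg _) hn 2
  rw [EuclideanSpace.norm_sq_eq, Real.sq_sqrt hB0] at this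
  simpa [hev] using this

/-- The Fourier transform of the indicator function of the unit interval. -/
noncomputable def boxFT (s : ℝ) : ℂ := ∫ u in (0:ℝ)..1, expI (-(u * s))

lemma half_le_norm_boxFT {s : ℝ} (hs : |s| ≤ 1 / 2) : 1 / 2 ≤ ‖boxFT s‖ := by
  have h1 : expI (s / 2) * boxFT s = ∫ u in (0:ℝ)..1, expI ((1 / 2 - u) * s) := by
    rw [boxFT, ← intervalIntegral.integral_const_mul]
    congr 1; ext u; rw [← expI_add]; congr 1; ring
  have h2 : ‖boxFT s‖ = ‖∫ u in (0:ℝ)..1, expI ((1 / 2 - u) * s)‖ := by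
    rw [← h1, norm_mul, norm_expI, one_mul]
  have h3 : (∫ u in (0:ℝ)..1, expI ((1 / 2 - u) * s)).re =
      ∫ u in (0:ℝ)..1, cos (2 * π * ((1 / 2 - u) * s)) := by
    simp_rw [← expI_re]
    exact (Complex.reCLM.intervalIntegral_comp_comm
      (Continuous.intervalIntegrable (by fun_prop) _ _)).symm
  have h4 : ∫ u in (0:ℝ)..1, (1 - (5:ℝ) * (1 / 2 - u) ^ 2) ≤
      ∫ u in (0:ℝ)..1, cos (2 * π * ((1 / 2 - u) * s)) := by
    refine intervalIntegral.integral_mono_on zero_le_one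
      (Continuous.intervalIntegrable (by fun_prop) _ _)
      (Continuous.intervalIntegrable (by fun_prop) _ _) fun u _ => ?_
    refine le_trans ?_ (one_sub_sq_div_two_le_cos (x := 2 * π * ((1 / 2 - u) * s)))
    have hs2 : s ^ 2 ≤ 1 / 4 := by
      rw [← sq_abs]; nlinarith [abs_nonneg s]
    have hp : π ^ 2 ≤ 10 := by nlinarith [pi_lt_d2, pi_pos]
    have : π ^ 2 * s ^ 2 ≤ 10 * (1 / 4) := by gcongr
    nlinarith [mul_le_mul_of_nonneg_right this (sq_nonneg (1 / 2 - u))]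
  have h5 : ∫ u in (0:ℝ)..1, (1 - (5:ℝ) * (1 / 2 - u) ^ 2) = 7 / 12 := by
    rw [intervalIntegral.integral_eq_sub_of_hasDerivAt
      (f := fun u => u + 5 / 3 * (1 / 2 - u) ^ 3)
      (fun u _ => ?_) (Continuous.intervalIntegrable (by fun_prop) _ _)]
    · norm_num
    · refine HasDerivAt.congr_deriv ((hasDerivAt_id u).add
        ((((hasDerivAt_id u).const_sub (1 / 2)).pow 3).const_mul (5 / 3))) ?_
      simp; ring
  rw [h2]
  refine le_trans ?_ (Complex.re_le_norm _)
  rw [h3]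
  linarith

/-- The indicator function of the unit interval. -/
noncomputable def box : ℝ → ℝ := Set.indicator (Set.Ico 0 1) 1

@[fun_prop]
lemma measurable_box : Measurable box := measurable_one.indicator measurableSet_Ico

lemma abs_box_le (x : ℝ) : |box x| ≤ 1 := by
  unfold box Set.indicator; split_ifs <;> simp

/-- The exponential sum `∑ p, box (p + u + w) exp (-2πi (p + u) s)` over the window. -/
noncomputable def boxSum (K : ℕ) (w s u : ℝ) : ℂ :=
  ∑ p, (box (ctr K p + u + w) : ℂ) * expI (-((ctr K p + u) * s))

lemma norm_boxSum_le (K : ℕ) (w s u : ℝ) : ‖boxSum K w s u‖ ≤ 2 * K + 1 := by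
  refine (norm_sum_le _ _).trans ?_
  refine (Finset.sum_le_card_nsmul _ _ 1 fun p _ => ?_).trans (by simp)
  rw [norm_mul, norm_expI, mul_one, Complex.norm_real]
  exact abs_box_le _

@[fun_prop]
lemma measurable_boxSum {X : Type*} [MeasurableSpace X] (K : ℕ) (s : ℝ) {w u : X → ℝ}
    (hw : Measurable w) (hu : Measurable u) : Measurable fun x => boxSum K (w x) s (u x) := by
  unfold boxSum
  refine Finset.measurable_sum _ fun p _ => ?_
  refine Measurable.mul ?_ ?_
  · exact Complex.measurable_ofReal.comp (measurable_box.comp (by fun_prop))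
  · exact continuous_expI.measurable.comp (by fun_prop)

lemma integral_box_mul {A B : ℝ} (hA : A ≤ 0) (hB : 1 ≤ B) (h : ℝ → ℂ) :
    ∫ x in A..B, (box x : ℂ) * h x = ∫ x in (0:ℝ)..1, h x := by
  have e : (fun x => (box x : ℂ) * h x) = Set.indicator (Set.Ico 0 1) h := by
    ext x; unfold box Set.indicator; split_ifs <;> simp
  rw [intervalIntegral.integral_of_le (by linarith), intervalIntegral.integral_of_le zero_le_one, e,
    ← integral_Ico_eq_integral_Ioc, setIntegral_indicator measurableSet_Ico,
    Set.inter_eq_right.2 (Set.Ico_subset_Ico hA hB), integral_Ico_eq_integral_Ioc]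

lemma integral_boxSum {K : ℕ} {w : ℝ} (hw : |w| ≤ K) (s : ℝ) :
    ∫ u in (0:ℝ)..1, boxSum K w s u = expI (w * s) * boxFT s := by
  set G : ℝ → ℂ := fun x => (box (x + w) : ℂ) * expI (-(x * s)) with hG
  have hGi : ∀ a b, IntervalIntegrable G volume a b := by
    intro a b
    have hm : Measurable G := by
      refine Measurable.mul ?_ ?_
      · exact Complex.measurable_ofReal.comp (measurable_box.comp (by fun_prop))
      · exact continuous_expI.measurable.comp (by fun_prop)
    refine (intervalIntegrable_const (c := (1:ℝ))).mono_fun hm.aestronglyMeasurable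
      (Filter.Eventually.of_forall fun x => ?_)
    simp only [hG]
    rw [norm_mul, norm_expI, mul_one, Complex.norm_real, norm_one]
    exact abs_box_le _
  have h1 : ∀ p : Fin (2 * K + 1), ∫ u in (0:ℝ)..1, G (ctr K p + u) =
      ∫ x in (((p : ℕ) : ℝ) - K)..(((p : ℕ) + 1 : ℕ) : ℝ) - K, G x := by
    intro p
    rw [intervalIntegral.integral_comp_add_left, ctr]
    congr 1 <;> push_cast <;> ring
  have hw' := abs_le.1 hw
  calc ∫ u in (0:ℝ)..1, boxSum K w s u
      = ∑ p, ∫ u in (0:ℝ)..1, G (ctr K p + u) := by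
        unfold boxSum
        rw [intervalIntegral.integral_finsetSum]
        intro p _
        have := (hGi (ctr K p + 0) (ctr K p + 1)).comp_add_left (c := ctr K p)
        simpa [hG] using this
    _ = ∫ x in (-(K:ℝ))..(K + 1), G x := by
        rw [Finset.sum_congr rfl fun p _ => h1 p, Fin.sum_univ_eq_sum_range
          (fun p : ℕ => ∫ x in ((p : ℝ) - K)..((p + 1 : ℕ) : ℝ) - K, G x),
          intervalIntegral.sum_integral_adjacent_intervals (a := fun p : ℕ => (p : ℝ) - K)
            fun p _ => hGi _ _]
        congr 1 <;> push_cast <;> ring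
    _ = ∫ x in (-(K:ℝ) + w)..(K + 1 + w), (box x : ℂ) * expI (-((x - w) * s)) := by
        rw [← intervalIntegral.integral_comp_add_right]
        simp [hG]
    _ = expI (w * s) * boxFT s := by
        rw [integral_box_mul (by linarith) (by linarith), boxFT,
          ← intervalIntegral.integral_const_mul]
        congr 1; ext u; rw [← expI_add]; congr 1; ring

lemma norm_integral_expI_ge (t s₁ s₂ : ℝ) :
    |besselInt (2 * π * ‖(⟨s₁, s₂⟩ : ℂ)‖ * t)| ≤
      ‖∫ θ in (0:ℝ)..(2 * π), expI (t * cos θ * s₁ + t * sin θ * s₂)‖ := by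
  set z : ℂ := ⟨s₁, s₂⟩ with hz
  have h1 : s₁ = ‖z‖ * cos z.arg := (Complex.norm_mul_cos_arg z).symm
  have h2 : s₂ = ‖z‖ * sin z.arg := (Complex.norm_mul_sin_arg z).symm
  have h3 : (∫ θ in (0:ℝ)..(2 * π), expI (t * cos θ * s₁ + t * sin θ * s₂)).re =
      ∫ θ in (0:ℝ)..(2 * π), cos (2 * π * (t * cos θ * s₁ + t * sin θ * s₂)) := by
    simp_rw [← expI_re]
    exact (Complex.reCLM.intervalIntegral_comp_comm
      (Continuous.intervalIntegrable (by fun_prop) _ _)).symm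
  have h4 : ∫ θ in (0:ℝ)..(2 * π), cos (2 * π * (t * cos θ * s₁ + t * sin θ * s₂)) =
      besselInt (2 * π * ‖z‖ * t) := by
    have hper : Function.Periodic (fun θ => cos (2 * π * ‖z‖ * t * cos θ)) (2 * π) := fun θ => by
      simp only [cos_add_two_pi]
    have := hper.intervalIntegral_add_eq (-z.arg) 0
    rw [zero_add] at this
    rw [besselInt, ← this, neg_add_eq_sub, ← zero_sub, ← intervalIntegral.integral_comp_sub_right
      (fun θ => cos (2 * π * ‖z‖ * t * cos θ))]
    congr 1; ext θ; rw [cos_sub, h1, h2]; congr 1; ring_nf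
  rw [← h4, ← h3]
  exact Complex.abs_re_le_norm _

lemma pt_zero (a b : ℝ) : pt a b 0 = a := rfl

lemma pt_one (a b : ℝ) : pt a b 1 = b := rfl

lemma box_ne_zero_iff {x : ℝ} : box x ≠ 0 ↔ x ∈ Set.Ico (0:ℝ) 1 := by
  unfold box Set.indicator; split_ifs <;> simp_all

lemma IsColoring.eq_sum_box {N K : ℕ} (hK : N ≤ K) {f : Pt → ℝ} (hf : IsColoring N f) (a b : ℝ) :
    f (pt a b) = ∑ r : Fin (2 * K + 1) × Fin (2 * K + 1),
      f (pt (ctr K r.1) (ctr K r.2)) * (box (a - ctr K r.1) * box (b - ctr K r.2)) := by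
  obtain ⟨-, h0, hc⟩ := hf
  have key : ∀ x : ℝ, ∀ p : Fin (2 * K + 1), box (x - ctr K p) ≠ 0 → ⌊x⌋ = (p : ℕ) - (K : ℤ) := by
    intro x p h
    rw [box_ne_zero_iff, ctr] at h
    rw [Int.floor_eq_iff]
    push_cast
    exact ⟨by linarith [h.1], by linarith [h.2]⟩
  by_cases h : ∀ i, pt a b i ∈ Set.Ico (0:ℝ) N
  · have ha := h 0
    have hb := h 1
    rw [pt_zero] at ha
    rw [pt_one] at hb
    have hex : ∀ x ∈ Set.Ico (0:ℝ) N, ∃ (i : ℕ) (p : Fin (2 * K + 1)), i < N ∧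
        x ∈ Set.Ico (i:ℝ) (i + 1) ∧ ctr K p = i ∧ box (x - ctr K p) = 1 := by
      intro x hx
      have hlt : ⌊x⌋₊ < N := (Nat.floor_lt hx.1).2 hx.2
      have hx1 : x ∈ Set.Ico (⌊x⌋₊ : ℝ) (⌊x⌋₊ + 1) := ⟨Nat.floor_le hx.1, Nat.lt_floor_add_one x⟩
      have hctr : ctr K ⟨⌊x⌋₊ + K, by omega⟩ = ⌊x⌋₊ := by simp [ctr]
      refine ⟨⌊x⌋₊, ⟨⌊x⌋₊ + K, by omega⟩, hlt, hx1, hctr, ?_⟩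
      rw [hctr]
      exact Set.indicator_of_mem (by exact ⟨by linarith [hx1.1], by linarith [hx1.2]⟩) _
    obtain ⟨i, p, hi, hai, hpi, hbox⟩ := hex a ha
    obtain ⟨j, q, hj, hbj, hqj, hbox'⟩ := hex b hb
    rw [Finset.sum_eq_single (p, q)]
    · rw [hbox, hbox', hpi, hqj, hc i j hi hj (pt a b) hai hbj]; ring
    · rintro ⟨p', q'⟩ - hne
      by_contra hn
      have hn' := right_ne_zero_of_mul hn
      have e1 := key a p' (left_ne_zero_of_mul hn')
      have e2 := key b q' (right_ne_zero_of_mul hn')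
      have e3 := key a p (by rw [hbox]; exact one_ne_zero)
      have e4 := key b q (by rw [hbox']; exact one_ne_zero)
      exact hne (Prod.ext (Fin.ext (by simp only; omega)) (Fin.ext (by simp only; omega)))
    · simp
  · rw [h0 _ h, eq_comm]
    refine Finset.sum_eq_zero fun r _ => ?_
    by_contra hn
    have hn' := right_ne_zero_of_mul hn
    have e1 := key a r.1 (left_ne_zero_of_mul hn')
    have e2 := key b r.2 (right_ne_zero_of_mul hn')
    refine left_ne_zero_of_mul hn (h0 _ fun hr => h fun i => ?_)
    have hmem : ∀ x : ℝ, ∀ p : Fin (2 * K + 1), ⌊x⌋ = (p : ℕ) - (K : ℤ) →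
        ctr K p ∈ Set.Ico (0:ℝ) N → x ∈ Set.Ico (0:ℝ) N := by
      intro x p hx hp
      have hp0 : ctr K p = (((p : ℕ) - (K : ℤ) : ℤ) : ℝ) := by simp [ctr]
      rw [hp0] at hp
      have h1 : (0:ℤ) ≤ (p : ℕ) - (K : ℤ) := by exact_mod_cast hp.1
      have h2 : (p : ℕ) - (K : ℤ) < N := by exact_mod_cast hp.2
      exact ⟨Int.floor_nonneg.1 (hx ▸ h1), by
        have := Int.floor_lt.1 (hx ▸ h2 : ⌊x⌋ < (N : ℤ)); exact_mod_cast this⟩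
    fin_cases i
    · exact hmem a r.1 e1 (hr 0)
    · exact hmem b r.2 e2 (hr 1)

lemma IsColoring.sq_le_sum {N K : ℕ} (hK : N ≤ K) {f : Pt → ℝ} (hf : IsColoring N f) :
    (N : ℝ) ^ 2 ≤ ∑ r : Fin (2 * K + 1) × Fin (2 * K + 1),
      ‖(f (pt (ctr K r.1) (ctr K r.2)) : ℂ)‖ ^ 2 := by
  set g : Fin N × Fin N → Fin (2 * K + 1) × Fin (2 * K + 1) :=
    fun x => (⟨x.1 + K, by omega⟩, ⟨x.2 + K, by omega⟩) with hg
  have hinj : Function.Injective g := by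
    rintro ⟨a, b⟩ ⟨c, d⟩ h
    simp only [hg, Prod.mk.injEq, Fin.mk.injEq] at h
    exact Prod.ext (Fin.ext (by simp only; omega)) (Fin.ext (by simp only; omega))
  calc (N : ℝ) ^ 2 = ∑ x : Fin N × Fin N, (1:ℝ) := by simp [sq]
    _ = ∑ x : Fin N × Fin N, ‖(f (pt (ctr K (g x).1) (ctr K (g x).2)) : ℂ)‖ ^ 2 := by
      refine Finset.sum_congr rfl fun x _ => ?_
      have e1 : ctr K (g x).1 = (x.1 : ℕ) := by simp [hg, ctr]
      have e2 : ctr K (g x).2 = (x.2 : ℕ) := by simp [hg, ctr]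
      rw [e1, e2, Complex.norm_real, Real.norm_eq_abs, sq_abs]
      have : ∀ i, pt (x.1 : ℕ) (x.2 : ℕ) i ∈ Set.Ico (0:ℝ) N := by
        intro i
        fin_cases i
        · exact ⟨Nat.cast_nonneg _, Nat.cast_lt.2 x.1.2⟩
        · exact ⟨Nat.cast_nonneg _, Nat.cast_lt.2 x.2.2⟩
      rcases hf.1 _ this with h | h <;> rw [h] <;> norm_num
    _ ≤ _ := by
      rw [← Finset.sum_image (f := fun r : Fin (2 * K + 1) × Fin (2 * K + 1) =>
        ‖(f (pt (ctr K r.1) (ctr K r.2)) : ℂ)‖ ^ 2) hinj.injOn]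
      exact Finset.sum_le_sum_of_subset_of_nonneg (Finset.subset_univ _)
        fun _ _ _ => sq_nonneg _

/-- The discrete Fourier transform of a function on the window. -/
noncomputable def windowDFT (K : ℕ) (f : Pt → ℝ) (q : Fin (2 * K + 1) × Fin (2 * K + 1)) : ℂ :=
  ∑ r : Fin (2 * K + 1) × Fin (2 * K + 1), (f (pt (ctr K r.1) (ctr K r.2)) : ℂ) *
    expI (-(ctr K r.1 * freq q.1 + ctr K r.2 * freq q.2))

/-- The Fourier coefficient of `x ↦ circDisc f t (x + u)` over the window. -/
noncomputable def discDFT (K : ℕ) (f : Pt → ℝ) (t : ℝ) (u : ℝ × ℝ)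
    (q : Fin (2 * K + 1) × Fin (2 * K + 1)) : ℂ :=
  ∑ p : Fin (2 * K + 1) × Fin (2 * K + 1),
    (circDisc f t (pt (ctr K p.1 + u.1) (ctr K p.2 + u.2)) : ℂ) *
      expI (-((ctr K p.1 + u.1) * freq q.1 + (ctr K p.2 + u.2) * freq q.2))

lemma circDisc_pt (f : Pt → ℝ) (t a b : ℝ) :
    circDisc f t (pt a b) =
      ∫ θ in (0:ℝ)..(2 * π), f (pt (a + t * cos θ) (b + t * sin θ)) * t := by
  unfold circDisc
  congr 1; ext θ; congr 2
  ext i; fin_cases i <;> simp [dir, pt]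

lemma sum_norm_discDFT_sq_le {K : ℕ} {f : Pt → ℝ} {t M : ℝ}
    (hM : ∀ x, |circDisc f t x| ≤ M) (u : ℝ × ℝ) :
    ∑ q, ‖discDFT K f t u q‖ ^ 2 ≤ (2 * K + 1) ^ 4 * M ^ 2 := by
  have e : ∀ q, ‖discDFT K f t u q‖ =
      ‖∑ p : Fin (2 * K + 1) × Fin (2 * K + 1),
        (circDisc f t (pt (ctr K p.1 + u.1) (ctr K p.2 + u.2)) : ℂ) *
        expI (-(ctr K p.1 * freq q.1 + ctr K p.2 * freq q.2))‖ := by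
    intro q
    rw [← one_mul ‖discDFT K f t u q‖, ← norm_expI (u.1 * freq q.1 + u.2 * freq q.2), ← norm_mul,
      discDFT, Finset.mul_sum]
    congr 1
    refine Finset.sum_congr rfl fun p _ => ?_
    rw [mul_left_comm, ← expI_add]
    congr 2; ring
  simp_rw [e]
  rw [parseval_window]
  have : ∑ p : Fin (2 * K + 1) × Fin (2 * K + 1),
      ‖(circDisc f t (pt (ctr K p.1 + u.1) (ctr K p.2 + u.2)) : ℂ)‖ ^ 2 ≤
      ∑ p : Fin (2 * K + 1) × Fin (2 * K + 1), M ^ 2 := by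
    gcongr with p
    rw [Complex.norm_real]
    exact hM _
  refine (mul_le_mul_of_nonneg_left this (by positivity)).trans (le_of_eq ?_)
  simp
  ring

/-- The contribution of the angle `θ` to `discDFT`, up to the factor `t`. -/
noncomputable def circSum (K : ℕ) (f : Pt → ℝ) (t s₁ s₂ : ℝ) (u : ℝ × ℝ) (θ : ℝ) : ℂ :=
  ∑ r : Fin (2 * K + 1) × Fin (2 * K + 1), (f (pt (ctr K r.1) (ctr K r.2)) : ℂ) *
    (boxSum K (t * cos θ - ctr K r.1) s₁ u.1 * boxSum K (t * sin θ - ctr K r.2) s₂ u.2)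

lemma integrable_circSum (K : ℕ) (f : Pt → ℝ) (t s₁ s₂ : ℝ) (μ : Measure (ℝ × ℝ)) (ν : Measure ℝ)
    [IsFiniteMeasure μ] [IsFiniteMeasure ν] :
    Integrable (Function.uncurry (circSum K f t s₁ s₂)) (μ.prod ν) := by
  unfold circSum Function.uncurry
  refine integrable_finsetSum _ fun r _ => Integrable.const_mul ?_ _
  refine Integrable.of_bound (C := (2 * K + 1) * (2 * K + 1))
    (Measurable.aestronglyMeasurable (by fun_prop)) (Filter.Eventually.of_forall fun x => ?_)
  rw [norm_mul]
  exact mul_le_mul (norm_boxSum_le _ _ _ _) (norm_boxSum_le _ _ _ _) (norm_nonneg _) (by positivity)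

lemma IsColoring.discDFT_eq {N K : ℕ} (hK : N ≤ K) {f : Pt → ℝ} (hf : IsColoring N f) (t : ℝ)
    (u : ℝ × ℝ) (q : Fin (2 * K + 1) × Fin (2 * K + 1)) :
    discDFT K f t u q =
      t * ∫ θ in Set.Ioc 0 (2 * π), circSum K f t (freq q.1) (freq q.2) u θ := by
  have hint : ∀ p : Fin (2 * K + 1) × Fin (2 * K + 1), Integrable
      (fun θ => (f (pt (ctr K p.1 + u.1 + t * cos θ) (ctr K p.2 + u.2 + t * sin θ)) : ℂ))
      (volume.restrict (Set.Ioc 0 (2 * π))) := by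
    intro p
    refine Integrable.ofReal ?_
    rw [funext fun θ => hf.eq_sum_box hK (ctr K p.1 + u.1 + t * cos θ)
      (ctr K p.2 + u.2 + t * sin θ)]
    refine integrable_finsetSum _ fun r _ => Integrable.const_mul ?_ _
    refine Integrable.of_bound (C := 1) (Measurable.aestronglyMeasurable ?_)
      (Filter.Eventually.of_forall fun x => ?_)
    · exact (measurable_box.comp (by fun_prop)).mul (measurable_box.comp (by fun_prop))
    · rw [norm_mul]
      exact mul_le_one₀ (abs_box_le _) (norm_nonneg _) (abs_box_le _)
  have e : ∀ p : Fin (2 * K + 1) × Fin (2 * K + 1),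
      (circDisc f t (pt (ctr K p.1 + u.1) (ctr K p.2 + u.2)) : ℂ) *
      expI (-((ctr K p.1 + u.1) * freq q.1 + (ctr K p.2 + u.2) * freq q.2)) =
      t * ∫ θ in Set.Ioc 0 (2 * π),
        (f (pt (ctr K p.1 + u.1 + t * cos θ) (ctr K p.2 + u.2 + t * sin θ)) : ℂ) *
        expI (-((ctr K p.1 + u.1) * freq q.1 + (ctr K p.2 + u.2) * freq q.2)) := by
    intro p
    rw [circDisc_pt, intervalIntegral.integral_mul_const, integral_mul_const,
      intervalIntegral.integral_of_le (by positivity), integral_complex_ofReal]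
    push_cast; ring
  unfold discDFT
  rw [Finset.sum_congr rfl fun p _ => e p, ← Finset.mul_sum,
    ← integral_finsetSum _ fun p _ => (hint p).mul_const _]
  congr 2; ext θ
  simp_rw [hf.eq_sum_box hK (_ + _)]
  unfold circSum boxSum
  push_cast
  simp_rw [Finset.sum_mul, Finset.mul_sum]
  rw [Finset.sum_comm]
  refine Finset.sum_congr rfl fun r _ => ?_
  rw [Fintype.sum_prod_type]
  refine Finset.sum_congr rfl fun p _ => ?_
  refine Finset.sum_congr rfl fun p' _ => ?_
  rw [neg_add, expI_add, add_sub_assoc, add_sub_assoc]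
  ring

/-- Lebesgue measure on the unit square. -/
noncomputable def squareMeasure : Measure (ℝ × ℝ) :=
  (volume.restrict (Set.Ioc 0 1)).prod (volume.restrict (Set.Ioc 0 1))

instance : IsProbabilityMeasure squareMeasure := by
  have : IsProbabilityMeasure ((volume : Measure ℝ).restrict (Set.Ioc 0 1)) := ⟨by simp⟩
  unfold squareMeasure; infer_instance

lemma IsColoring.integral_circSum {N K : ℕ} {f : Pt → ℝ} (hf : IsColoring N f) {t : ℝ}
    (hK : |t| + N ≤ K) (q : Fin (2 * K + 1) × Fin (2 * K + 1)) (θ : ℝ) :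
    ∫ u, circSum K f t (freq q.1) (freq q.2) u θ ∂squareMeasure =
      expI (t * cos θ * freq q.1 + t * sin θ * freq q.2) *
        (windowDFT K f q * (boxFT (freq q.1) * boxFT (freq q.2))) := by
  have h1 : ∀ w s : ℝ, |w| ≤ K →
      ∫ u in Set.Ioc 0 1, boxSum K w s u = expI (w * s) * boxFT s := fun w s hw => by
    rw [← integral_boxSum hw, intervalIntegral.integral_of_le zero_le_one]
  unfold circSum squareMeasure
  rw [integral_finsetSum]
  · rw [windowDFT, Finset.sum_mul, Finset.mul_sum]
    refine Finset.sum_congr rfl fun r _ => ?_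
    rw [integral_const_mul, integral_prod_mul (boxSum K (t * cos θ - ctr K r.1) (freq q.1))
      (boxSum K (t * sin θ - ctr K r.2) (freq q.2))]
    by_cases hr : ∀ i, pt (ctr K r.1) (ctr K r.2) i ∈ Set.Ico (0:ℝ) N
    · have hw : ∀ c d : ℝ, |c| ≤ 1 → d ∈ Set.Ico (0:ℝ) N → |t * c - d| ≤ K := by
        intro c d hc hd
        refine (abs_sub _ _).trans (le_trans (add_le_add ?_ ?_) hK)
        · rw [abs_mul]; exact mul_le_of_le_one_right (abs_nonneg _) hc
        · rw [abs_of_nonneg hd.1]; exact hd.2.le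
      rw [h1 _ _ (hw _ (ctr K r.1) (abs_cos_le_one θ) (hr 0)), h1 _ _ (hw _ (ctr K r.2) (abs_sin_le_one θ) (hr 1))]
      have : expI ((t * cos θ - ctr K r.1) * freq q.1) * expI ((t * sin θ - ctr K r.2) * freq q.2) =
          expI (t * cos θ * freq q.1 + t * sin θ * freq q.2) *
          expI (-(ctr K r.1 * freq q.1 + ctr K r.2 * freq q.2)) := by
        rw [← expI_add, ← expI_add]; congr 1; ring
      linear_combination (f (pt (ctr K r.1) (ctr K r.2)) : ℂ) *
        (boxFT (freq q.1) * boxFT (freq q.2)) * this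
    · rw [hf.2.1 _ hr]; simp
  · intro r _
    refine Integrable.const_mul ?_ _
    refine Integrable.of_bound (C := (2 * K + 1) * (2 * K + 1))
      (Measurable.aestronglyMeasurable (by fun_prop)) (Filter.Eventually.of_forall fun x => ?_)
    rw [norm_mul]
    exact mul_le_mul (norm_boxSum_le _ _ _ _) (norm_boxSum_le _ _ _ _) (norm_nonneg _)
      (by positivity)

lemma IsColoring.integral_discDFT {N K : ℕ} {f : Pt → ℝ} (hf : IsColoring N f) {t : ℝ}
    (hK : |t| + N ≤ K) (q : Fin (2 * K + 1) × Fin (2 * K + 1)) :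
    ∫ u, discDFT K f t u q ∂squareMeasure =
      t * ((∫ θ in (0:ℝ)..(2 * π), expI (t * cos θ * freq q.1 + t * sin θ * freq q.2)) *
        (windowDFT K f q * (boxFT (freq q.1) * boxFT (freq q.2)))) := by
  have hNK : N ≤ K := by
    have : (N : ℝ) ≤ K := by linarith [abs_nonneg t]
    exact_mod_cast this
  simp_rw [hf.discDFT_eq hNK]
  rw [integral_const_mul, integral_integral_swap (integrable_circSum K f t _ _ _ _)]
  simp_rw [hf.integral_circSum hK]
  rw [integral_mul_const, intervalIntegral.integral_of_le (by positivity)]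

lemma IsColoring.sum_windowDFT_le {N K : ℕ} {f : Pt → ℝ} (hf : IsColoring N f) {t M : ℝ}
    (hK : |t| + N ≤ K) (hM : ∀ x, |circDisc f t x| ≤ M) :
    t ^ 2 * ∑ q : Fin (2 * K + 1) × Fin (2 * K + 1), ‖windowDFT K f q‖ ^ 2 *
      besselInt (2 * π * ‖(⟨freq q.1, freq q.2⟩ : ℂ)‖ * t) ^ 2 ≤
      16 * ((2 * K + 1) ^ 4 * M ^ 2) := by
  have hNK : N ≤ K := by
    have : (N : ℝ) ≤ K := by linarith [abs_nonneg t]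
    exact_mod_cast this
  have hint : ∀ q, Integrable (fun u => discDFT K f t u q) squareMeasure := by
    intro q
    simp_rw [hf.discDFT_eq hNK]
    exact (integrable_circSum K f t _ _ _ _).integral_prod_left.const_mul _
  have h := sum_norm_integral_sq_le hint (sum_norm_discDFT_sq_le hM)
  refine le_trans ?_ (mul_le_mul_of_nonneg_left h (by norm_num))
  rw [Finset.mul_sum, Finset.mul_sum]
  refine Finset.sum_le_sum fun q _ => ?_
  rw [hf.integral_discDFT hK, norm_mul, norm_mul, norm_mul, norm_mul, Complex.norm_real,
    Real.norm_eq_abs]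
  have hb := norm_integral_expI_ge t (freq q.1) (freq q.2)
  set A := ‖∫ θ in (0:ℝ)..(2 * π), expI (t * cos θ * freq q.1 + t * sin θ * freq q.2)‖
  have hA : besselInt (2 * π * ‖(⟨freq q.1, freq q.2⟩ : ℂ)‖ * t) ^ 2 ≤ A ^ 2 := by
    rw [← sq_abs]; exact pow_le_pow_left₀ (abs_nonneg _) hb 2
  have hB : 1 ≤ 4 * (‖boxFT (freq q.1)‖ * ‖boxFT (freq q.2)‖) := by
    have := mul_le_mul (half_le_norm_boxFT (abs_freq_le q.1)) (half_le_norm_boxFT (abs_freq_le q.2))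
      (by norm_num) (norm_nonneg _)
    linarith
  set B := ‖boxFT (freq q.1)‖ * ‖boxFT (freq q.2)‖
  have hB2 : 1 ≤ 16 * B ^ 2 := by nlinarith
  calc _ ≤ t ^ 2 * (‖windowDFT K f q‖ ^ 2 * A ^ 2) * 1 := by rw [mul_one]; gcongr
    _ ≤ t ^ 2 * (‖windowDFT K f q‖ ^ 2 * A ^ 2) * (16 * B ^ 2) := by gcongr
    _ = _ := by rw [mul_pow, mul_pow, mul_pow, sq_abs]; ring

/-- For every coloring of the `N × N` checkerboard there is a circle of radius
`t ∈ (N/5, N/4)` whose discrepancy is at least `C √N`, `C > 0` an absolute constant. -/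
theorem exists_circle_large_discrepancy :
    ∃ C > (0:ℝ), ∀ (N : ℕ), 1 ≤ N → ∀ f : Pt → ℝ, IsColoring N f →
      ∃ (x : Pt) (t : ℝ), (N : ℝ) / 5 < t ∧ t < (N : ℝ) / 4 ∧
        C * Real.sqrt N ≤ |circDisc f t x| := by
  obtain ⟨c, hc, hbessel⟩ := exists_le_integral_besselInt_sq
  refine ⟨√(c / 8000), by positivity, fun N hN f hf => ?_⟩
  by_contra! hsmall
  set M : ℝ := √(c / 8000) * √N with hMdef
  have hM2 : M ^ 2 = c / 8000 * N := by
    rw [hMdef, mul_pow, Real.sq_sqrt (by positivity), Real.sq_sqrt (by positivity)]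
  have hN' : (1:ℝ) ≤ N := by exact_mod_cast hN
  have hN0 : (0:ℝ) < N := by linarith
  set K := 2 * N with hK
  set ρ : Fin (2 * K + 1) × Fin (2 * K + 1) → ℝ := fun q => ‖(⟨freq q.1, freq q.2⟩ : ℂ)‖ with hρ
  have hρ1 : ∀ q, ρ q ≤ 1 := fun q =>
    (Complex.norm_le_abs_re_add_abs_im _).trans
      (by simp only; linarith [abs_freq_le q.1, abs_freq_le q.2])
  have hpt : ∀ t ∈ Set.Ioo ((N:ℝ) / 5) (N / 4),
      ∑ q, ‖windowDFT K f q‖ ^ 2 * besselInt (2 * π * ρ q * t) ^ 2 ≤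
        400 * ((2 * K + 1) ^ 4 * M ^ 2) / N ^ 2 := by
    rintro t ⟨ht1, ht2⟩
    have ht0 : 0 < t := by linarith
    have h := hf.sum_windowDFT_le (K := K) (t := t) (M := M)
      (by rw [abs_of_pos ht0, hK]; push_cast; linarith) fun x => (hsmall x t ht1 ht2).le
    have h0 : 0 ≤ ∑ q, ‖windowDFT K f q‖ ^ 2 * besselInt (2 * π * ρ q * t) ^ 2 :=
      Finset.sum_nonneg fun q _ => by positivity
    have ht : (N / 5 : ℝ) ^ 2 ≤ t ^ 2 := by gcongr
    rw [le_div_iff₀ (by positivity)]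
    nlinarith [mul_le_mul_of_nonneg_right ht h0]
  have hcont : ∀ q, Continuous fun t => ‖windowDFT K f q‖ ^ 2 * besselInt (2 * π * ρ q * t) ^ 2 :=
    fun q => continuous_const.mul ((continuous_besselInt.comp (continuous_const_mul _)).pow 2)
  have hupper : ∑ q, ‖windowDFT K f q‖ ^ 2 *
      ∫ t in ((N:ℝ) / 5)..(N / 4), besselInt (2 * π * ρ q * t) ^ 2 ≤
        (N / 4 - N / 5) * (400 * ((2 * K + 1) ^ 4 * M ^ 2) / N ^ 2) := by
    have := intervalIntegral.integral_mono_on_of_le_Ioo (μ := volume)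
      (by linarith : (N:ℝ) / 5 ≤ N / 4)
      ((continuous_finsetSum _ fun q _ => hcont q).intervalIntegrable _ _)
      intervalIntegrable_const hpt
    rw [intervalIntegral.integral_const, smul_eq_mul, intervalIntegral.integral_finsetSum
      fun q _ => (hcont q).intervalIntegrable _ _] at this
    simpa only [intervalIntegral.integral_const_mul] using this
  have hlower : ∀ q, c / 8 ≤ ∫ t in ((N:ℝ) / 5)..(N / 4), besselInt (2 * π * ρ q * t) ^ 2 := by
    intro q
    have hρ0 : 0 ≤ ρ q := norm_nonneg _
    have e := intervalIntegral.integral_comp_mul_left (a := 1 / 5) (b := 1 / 4)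
      (fun t => besselInt (2 * π * ρ q * t) ^ 2) hN0.ne'
    simp only [← mul_assoc] at e
    rw [mul_one_div, mul_one_div, smul_eq_mul] at e
    have h := hbessel (2 * π * ρ q * N) (by positivity)
    rw [e, div_le_iff₀ (by positivity)] at h
    have hI : 0 ≤ ∫ t in ((N:ℝ) / 5)..(N / 4), besselInt (2 * π * ρ q * t) ^ 2 :=
      intervalIntegral.integral_nonneg (by linarith) fun _ _ => sq_nonneg _
    have hl : (N:ℝ)⁻¹ * (1 + 2 * π * ρ q * N) ≤ 8 := by
      rw [inv_mul_le_iff₀ hN0]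
      have : 2 * π * ρ q ≤ 7 * 1 := by
        gcongr
        · linarith [pi_lt_d2]
        · exact hρ1 q
      nlinarith
    nlinarith
  have hpars : (2 * K + 1 : ℝ) ^ 2 * N ^ 2 ≤ ∑ q, ‖windowDFT K f q‖ ^ 2 := by
    unfold windowDFT
    rw [parseval_window]
    gcongr
    exact hf.sq_le_sum (by omega)
  have hfin : (2 * K + 1 : ℝ) ^ 2 * N ^ 2 * (c / 8) ≤
      (N / 4 - N / 5) * (400 * ((2 * K + 1) ^ 4 * M ^ 2) / N ^ 2) := by
    refine le_trans ?_ hupper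
    refine (mul_le_mul_of_nonneg_right hpars (by positivity)).trans ?_
    rw [Finset.sum_mul]
    gcongr with q
    exact hlower q
  rw [hM2] at hfin
  have e : (N / 4 - N / 5 : ℝ) * (400 * ((2 * K + 1) ^ 4 * (c / 8000 * N)) / N ^ 2) =
      (2 * K + 1) ^ 2 * (c / 8) * ((2 * K + 1) ^ 2 / 50) := by
    field_simp; ring
  have hL : (2 * K + 1 : ℝ) ^ 2 ≤ (5 * N) ^ 2 := by
    have : (2 * K + 1 : ℝ) ≤ 5 * N := by rw [hK]; push_cast; linarith
    gcongr
  have hp : (0:ℝ) < (2 * K + 1) ^ 2 * (c / 8) := by positivity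
  rw [e, show (2 * K + 1 : ℝ) ^ 2 * N ^ 2 * (c / 8) = (2 * K + 1) ^ 2 * (c / 8) * N ^ 2 by ring,
    mul_le_mul_iff_right₀ hp] at hfin
  nlinarith [pow_pos hN0 2]
end
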